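/- arXiv:1807.11211 — 2 statements merged into one kernel-verified Lean document; each statement's English description precedes it below -/
import Mathlib

section
/- For every integer n ≥ 6, every Berge-K4-free triple system on an n-element vertex set has at most f(n) = ⌊n/3⌋·⌊(n+1)/3⌋·⌊(n+2)/3⌋ triples. -/
/-- `HasBergeK4 H` : `H` contains a Berge-`K₄`, i.e. four distinct vertices
`v₁, v₂, v₃, v₄` and six pairwise distinct triples `e_{ij} ∈ H` with
`{vᵢ, vⱼ} ⊆ e_{ij}` for every `1 ≤ i < j ≤ 4`. -/
def HasBergeK4 {V : Type*} [DecidableEq V] (H : Finset (Finset V)) : Prop :=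
  ∃ v₁ v₂ v₃ v₄ : V, ∃ e₁₂ e₁₃ e₁₄ e₂₃ e₂₄ e₃₄ : Finset V,
    v₁ ≠ v₂ ∧ v₁ ≠ v₃ ∧ v₁ ≠ v₄ ∧ v₂ ≠ v₃ ∧ v₂ ≠ v₄ ∧ v₃ ≠ v₄ ∧
    ([e₁₂, e₁₃, e₁₄, e₂₃, e₂₄, e₃₄] : List (Finset V)).Nodup ∧
    e₁₂ ∈ H ∧ e₁₃ ∈ H ∧ e₁₄ ∈ H ∧ e₂₃ ∈ H ∧ e₂₄ ∈ H ∧ e₃₄ ∈ H ∧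
    {v₁, v₂} ⊆ e₁₂ ∧ {v₁, v₃} ⊆ e₁₃ ∧ {v₁, v₄} ⊆ e₁₄ ∧
    {v₂, v₃} ⊆ e₂₃ ∧ {v₂, v₄} ⊆ e₂₄ ∧ {v₃, v₄} ⊆ e₃₄

/-- Twice the number of edges inside `W`, for a weight `A` which is the indicator of a graph. -/
def pairSum {V : Type*} (A : V → V → ℤ) (W : Finset V) : ℤ :=
  ∑ x ∈ W, ∑ y ∈ W, A x y

/-- Six times the number of triangles inside `W`, for the indicator `A` of a graph. -/
def triangleSum {V : Type*} (A : V → V → ℤ) (W : Finset V) : ℤ :=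
  ∑ x ∈ W, ∑ y ∈ W, ∑ z ∈ W, A x y * A x z * A y z

/-- `A` is the indicator function of the adjacency relation of a `K₄`-free graph. -/
structure IsK4FreeIndicator {V : Type*} (A : V → V → ℤ) : Prop where
  zero_or_one : ∀ x y, A x y = 0 ∨ A x y = 1
  symm : ∀ x y, A x y = A y x
  diag : ∀ x, A x x = 0
  k4_free : ∀ a b c d, A a b = 1 → A a c = 1 → A a d = 1 → A b c = 1 → A b d = 1 → A c d ≠ 1

section

variable {V : Type*} {A : V → V → ℤ} {a b c : V}

/-- A vertex outside a triangle `abc` has at most two neighbours in it. -/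
theorem IsK4FreeIndicator.sum_triangle_le (h : IsK4FreeIndicator A)
    (hab : A a b = 1) (hac : A a c = 1) (hbc : A b c = 1) (x : V) :
    A x a + A x b + A x c ≤ 2 := by
  have := h.k4_free x a b c
  rcases h.zero_or_one x a with h1 | h1 <;> rcases h.zero_or_one x b with h2 | h2 <;>
    rcases h.zero_or_one x c with h3 | h3 <;> simp_all

/-- Adjacent vertices have at most one common neighbour in a triangle `abc`. -/
theorem IsK4FreeIndicator.common_triangle_le (h : IsK4FreeIndicator A)
    (hab : A a b = 1) (hac : A a c = 1) (hbc : A b c = 1) {x y : V} (hxy : A x y = 1) :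
    A x a * A y a + A x b * A y b + A x c * A y c ≤ 1 := by
  have h1 := h.k4_free x y a b hxy
  have h2 := h.k4_free x y a c hxy
  have h3 := h.k4_free x y b c hxy
  rcases h.zero_or_one x a with e1 | e1 <;> rcases h.zero_or_one x b with e2 | e2 <;>
    rcases h.zero_or_one x c with e3 | e3 <;> rcases h.zero_or_one y a with e4 | e4 <;>
    rcases h.zero_or_one y b with e5 | e5 <;> rcases h.zero_or_one y c with e6 | e6 <;>
    simp_all

variable [DecidableEq V] {W : Finset V}

theorem pairSum_insert (hs : ∀ x y, A x y = A y x) (hd : ∀ x, A x x = 0) (ha : a ∉ W) :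
    pairSum A (insert a W) = pairSum A W + 2 * ∑ x ∈ W, A x a := by
  simp only [pairSum, Finset.sum_insert ha, Finset.sum_add_distrib, hd]
  rw [Finset.sum_congr rfl fun x _ => hs a x]
  ring

theorem triangleSum_insert (hs : ∀ x y, A x y = A y x) (hd : ∀ x, A x x = 0) (ha : a ∉ W) :
    triangleSum A (insert a W) =
      triangleSum A W + 3 * pairSum (fun x y => A x y * A x a * A y a) W := by
  simp only [pairSum, triangleSum, Finset.sum_insert ha, Finset.sum_add_distrib, hd, zero_mul,
    mul_zero, Finset.sum_const_zero, zero_add]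
  have h1 : ∑ x ∈ W, ∑ y ∈ W, A a x * A a y * A x y = ∑ x ∈ W, ∑ y ∈ W, A x y * A x a * A y a :=
    Finset.sum_congr rfl fun x _ => Finset.sum_congr rfl fun y _ => by
      rw [hs a x, hs a y]; ring
  have h2 : ∑ x ∈ W, ∑ y ∈ W, A x a * A x y * A a y = ∑ x ∈ W, ∑ y ∈ W, A x y * A x a * A y a :=
    Finset.sum_congr rfl fun x _ => Finset.sum_congr rfl fun y _ => by
      rw [hs a y]; ring
  rw [h1, h2]
  ring

theorem pairSum_insert_three (h : IsK4FreeIndicator A) (ha : a ∉ W) (hb : b ∉ W) (hc : c ∉ W)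
    (hab : A a b = 1) (hac : A a c = 1) (hbc : A b c = 1) :
    pairSum A (insert a (insert b (insert c W))) =
      pairSum A W + 2 * ∑ x ∈ W, (A x a + A x b + A x c) + 6 := by
  have nab : a ≠ b := by rintro rfl; simp [h.diag] at hab
  have nac : a ≠ c := by rintro rfl; simp [h.diag] at hac
  have nbc : b ≠ c := by rintro rfl; simp [h.diag] at hbc
  have hb' : b ∉ insert c W := by simp [nbc, hb]
  have ha' : a ∉ insert b (insert c W) := by simp [nab, nac, ha]
  rw [pairSum_insert h.symm h.diag ha', pairSum_insert h.symm h.diag hb',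
    pairSum_insert h.symm h.diag hc, Finset.sum_insert hb', Finset.sum_insert hc,
    Finset.sum_insert hc, h.symm b a, h.symm c a, h.symm c b, hab, hac, hbc]
  simp only [Finset.sum_add_distrib]
  ring

theorem triangleSum_insert_three (h : IsK4FreeIndicator A) (ha : a ∉ W) (hb : b ∉ W) (hc : c ∉ W)
    (hab : A a b = 1) (hac : A a c = 1) (hbc : A b c = 1) :
    triangleSum A (insert a (insert b (insert c W))) =
      triangleSum A W + 3 * ∑ x ∈ W, ∑ y ∈ W,
        A x y * (A x a * A y a + A x b * A y b + A x c * A y c) +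
      6 * ∑ x ∈ W, (A x a * A x b + A x a * A x c + A x b * A x c) + 6 := by
  have nab : a ≠ b := by rintro rfl; simp [h.diag] at hab
  have nac : a ≠ c := by rintro rfl; simp [h.diag] at hac
  have nbc : b ≠ c := by rintro rfl; simp [h.diag] at hbc
  have hb' : b ∉ insert c W := by simp [nbc, hb]
  have ha' : a ∉ insert b (insert c W) := by simp [nab, nac, ha]
  have hs : ∀ v x y, A x y * A x v * A y v = A y x * A y v * A x v := fun v x y => by
    rw [h.symm x y]; ring
  have hd : ∀ v x, A x x * A x v * A x v = 0 := fun v x => by rw [h.diag]; ring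
  rw [triangleSum_insert h.symm h.diag ha', triangleSum_insert h.symm h.diag hb',
    triangleSum_insert h.symm h.diag hc, pairSum_insert (hs a) (hd a) hb',
    pairSum_insert (hs a) (hd a) hc, pairSum_insert (hs b) (hd b) hc, Finset.sum_insert hc,
    h.symm b a, h.symm c a, h.symm c b, hab, hac, hbc]
  simp only [pairSum, Finset.sum_add_distrib, mul_add, mul_one, mul_assoc]
  rw [Finset.sum_congr rfl fun x _ => mul_comm (A x b) (A x a),
    Finset.sum_congr rfl fun x _ => mul_comm (A x c) (A x a),
    Finset.sum_congr rfl fun x _ => mul_comm (A x c) (A x b)]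
  ring

theorem exists_insert_three_of_mem {a b c : V} (ha : a ∈ W) (hb : b ∈ W) (hc : c ∈ W)
    (hab : a ≠ b) (hac : a ≠ c) (hbc : b ≠ c) :
    ∃ U : Finset V, a ∉ U ∧ b ∉ U ∧ c ∉ U ∧ W = insert a (insert b (insert c U)) ∧
      W.card = U.card + 3 := by
  have h : W = insert a (insert b (insert c (((W.erase a).erase b).erase c))) := by
    ext x; simp; grind
  refine ⟨((W.erase a).erase b).erase c, by simp, by simp, by simp, h, ?_⟩
  conv_lhs => rw [h]
  rw [Finset.card_insert_of_notMem (by simp [hab, hac]),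
    Finset.card_insert_of_notMem (by simp [hbc]), Finset.card_insert_of_notMem (by simp)]

/-- Turán's theorem for `K₄`. -/
theorem pairSum_le (h : IsK4FreeIndicator A) (W : Finset V) :
    pairSum A W ≤ 2 * ((W.card ^ 2 / 3 : ℕ) : ℤ) := by
  induction hn : W.card using Nat.strong_induction_on generalizing W with
  | _ n ih =>
  by_cases ht : ∃ a ∈ W, ∃ b ∈ W, ∃ c ∈ W, A a b = 1 ∧ A a c = 1 ∧ A b c = 1
  · obtain ⟨a, ha, b, hb, c, hc, hab, hac, hbc⟩ := ht
    obtain ⟨U, haU, hbU, hcU, rfl, hcard⟩ := exists_insert_three_of_mem ha hb hc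
      (by rintro rfl; simp [h.diag] at hab) (by rintro rfl; simp [h.diag] at hac)
      (by rintro rfl; simp [h.diag] at hbc)
    rw [pairSum_insert_three h haU hbU hcU hab hac hbc]
    have h1 := ih U.card (by omega) U rfl
    have h2 : ∑ x ∈ U, (A x a + A x b + A x c) ≤ ∑ x ∈ U, 2 :=
      Finset.sum_le_sum fun x _ => h.sum_triangle_le hab hac hbc x
    have h3 : n ^ 2 / 3 = U.card ^ 2 / 3 + 2 * U.card + 3 := by
      rw [← hn, hcard, show (U.card + 3) ^ 2 = U.card ^ 2 + (2 * U.card + 3) * 3 by ring,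
        Nat.add_mul_div_right _ _ (by norm_num)]
      ring
    simp only [Finset.sum_const, nsmul_eq_mul] at h2
    rw [h3]
    push_cast at h1 ⊢
    linarith
  · by_cases he : ∃ a ∈ W, ∃ b ∈ W, A a b = 1
    · obtain ⟨a, ha, b, hb, hab⟩ := he
      have nab : a ≠ b := by rintro rfl; simp [h.diag] at hab
      have hW : W = insert a (insert b ((W.erase a).erase b)) := by ext x; simp; grind
      set U := (W.erase a).erase b with hU
      have hbU : b ∉ U := by simp [hU]
      have haU : a ∉ insert b U := by simp [hU, nab]
      have hcard : n = U.card + 2 := by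
        rw [← hn, hW, Finset.card_insert_of_notMem haU, Finset.card_insert_of_notMem hbU]
      have h1 := ih U.card (by omega) U rfl
      have h2 : ∑ x ∈ U, (A x a + A x b) ≤ ∑ x ∈ U, 1 := Finset.sum_le_sum fun x hx => by
        have hx' : x ∈ W := by rw [hW]; simp [hx]
        by_contra hlt
        refine ht ⟨a, ha, b, hb, x, hx', hab, ?_, ?_⟩
        · rw [h.symm]
          rcases h.zero_or_one x a with h1 | h1 <;> rcases h.zero_or_one x b with h2 | h2 <;> omega
        · rw [h.symm]
          rcases h.zero_or_one x a with h1 | h1 <;> rcases h.zero_or_one x b with h2 | h2 <;> omega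
      rw [hW, pairSum_insert h.symm h.diag haU, pairSum_insert h.symm h.diag hbU,
        Finset.sum_insert hbU, h.symm b a, hab]
      have h3 : U.card ^ 2 / 3 + U.card + 1 ≤ n ^ 2 / 3 := by
        rw [hcard, show (U.card + 2) ^ 2 = U.card ^ 2 + 4 * U.card + 4 by ring]
        omega
      simp only [Finset.sum_const, nsmul_eq_mul, Finset.sum_add_distrib] at h2
      zify at h3
      push_cast at h1 ⊢
      linarith
    · have : pairSum A W = 0 := Finset.sum_eq_zero fun x hx => Finset.sum_eq_zero fun y hy => by
        rcases h.zero_or_one x y with h1 | h1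
        · exact h1
        · exact absurd ⟨x, hx, y, hy, h1⟩ he
      rw [this]
      positivity

/-- The number of triples of the balanced complete 3-partite triple system. -/
def tripartite (n : ℕ) : ℕ := n / 3 * ((n + 1) / 3) * ((n + 2) / 3)

theorem tripartite_add_three (n : ℕ) :
    tripartite (n + 3) = tripartite n + n ^ 2 / 3 + n + 1 := by
  unfold tripartite
  obtain ⟨k, rfl | rfl | rfl⟩ : ∃ k, n = 3 * k ∨ n = 3 * k + 1 ∨ n = 3 * k + 2 := ⟨n / 3, by omega⟩
  · rw [show (3 * k + 3) / 3 = k + 1 by omega, show (3 * k + 3 + 1) / 3 = k + 1 by omega,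
      show (3 * k + 3 + 2) / 3 = k + 1 by omega, show 3 * k / 3 = k by omega,
      show (3 * k + 1) / 3 = k by omega, show (3 * k + 2) / 3 = k by omega,
      show (3 * k) ^ 2 = 3 * k ^ 2 * 3 by ring, Nat.mul_div_cancel _ (by norm_num)]
    ring
  · rw [show (3 * k + 1 + 3) / 3 = k + 1 by omega, show (3 * k + 1 + 3 + 1) / 3 = k + 1 by omega,
      show (3 * k + 1 + 3 + 2) / 3 = k + 2 by omega, show (3 * k + 1 + 1) / 3 = k by omega,
      show (3 * k + 1) / 3 = k by omega, show (3 * k + 1 + 2) / 3 = k + 1 by omega,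
      show (3 * k + 1) ^ 2 = 1 + (3 * k ^ 2 + 2 * k) * 3 by ring,
      Nat.add_mul_div_right _ _ (by norm_num)]
    ring
  · rw [show (3 * k + 2 + 3) / 3 = k + 1 by omega, show (3 * k + 2 + 3 + 1) / 3 = k + 2 by omega,
      show (3 * k + 2 + 3 + 2) / 3 = k + 2 by omega, show (3 * k + 2 + 1) / 3 = k + 1 by omega,
      show (3 * k + 2) / 3 = k by omega, show (3 * k + 2 + 2) / 3 = k + 1 by omega,
      show (3 * k + 2) ^ 2 = 1 + (3 * k ^ 2 + 4 * k + 1) * 3 by ring,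
      Nat.add_mul_div_right _ _ (by norm_num)]
    ring

theorem sq_div_three_add_three (n : ℕ) : (n + 3) ^ 2 / 3 = n ^ 2 / 3 + 2 * n + 3 := by
  rw [show (n + 3) ^ 2 = n ^ 2 + (2 * n + 3) * 3 by ring, Nat.add_mul_div_right _ _ (by norm_num)]
  ring

theorem tripartite_add_sq_div_three_succ (n : ℕ) (hn : 5 ≤ n) :
    tripartite n + (n + 1) ^ 2 / 3 ≤ tripartite (n + 1) + n ^ 2 / 3 := by
  unfold tripartite
  obtain ⟨k, rfl | rfl | rfl⟩ : ∃ k, n = 3 * k ∨ n = 3 * k + 1 ∨ n = 3 * k + 2 := ⟨n / 3, by omega⟩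
  · rw [show (3 * k + 1 + 1) / 3 = k by omega, show (3 * k + 1 + 2) / 3 = k + 1 by omega,
      show 3 * k / 3 = k by omega, show (3 * k + 1) / 3 = k by omega,
      show (3 * k) ^ 2 = 3 * k ^ 2 * 3 by ring,
      show (3 * k + 1) ^ 2 = 1 + (3 * k ^ 2 + 2 * k) * 3 by ring,
      Nat.add_mul_div_right _ _ (by norm_num), Nat.mul_div_cancel _ (by norm_num),
      show 1 / 3 = 0 from rfl]
    nlinarith [show 2 ≤ k by omega]
  · rw [show (3 * k + 1 + 1) / 3 = k by omega, show (3 * k + 1 + 1 + 1) / 3 = k + 1 by omega,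
      show (3 * k + 1 + 1 + 2) / 3 = k + 1 by omega, show (3 * k + 1) / 3 = k by omega,
      show (3 * k + 1) ^ 2 = 1 + (3 * k ^ 2 + 2 * k) * 3 by ring,
      show (3 * k + 1 + 1) ^ 2 = 1 + (3 * k ^ 2 + 4 * k + 1) * 3 by ring,
      Nat.add_mul_div_right _ _ (by norm_num), Nat.add_mul_div_right _ _ (by norm_num)]
    nlinarith [show 2 ≤ k by omega]
  · rw [show (3 * k + 2 + 1) / 3 = k + 1 by omega, show (3 * k + 2 + 1 + 1) / 3 = k + 1 by omega,
      show (3 * k + 2 + 1 + 2) / 3 = k + 1 by omega, show (3 * k + 2) / 3 = k by omega,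
      show (3 * k + 2) ^ 2 = 1 + (3 * k ^ 2 + 4 * k + 1) * 3 by ring,
      show (3 * k + 2 + 1) ^ 2 = (3 * k ^ 2 + 6 * k + 3) * 3 by ring,
      Nat.add_mul_div_right _ _ (by norm_num), Nat.mul_div_cancel _ (by norm_num),
      show 1 / 3 = 0 from rfl]
    nlinarith [show 1 ≤ k by omega]

/-- The difference between the extremal numbers of triples and of edges is maximal at `n ≥ 9`
among all smaller orders. -/
theorem tripartite_sub_sq_div_three_le (m n : ℕ) (hmn : m + 3 ≤ n) (hn : 9 ≤ n) :
    tripartite m + n ^ 2 / 3 ≤ tripartite n + m + 2 := by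
  suffices H : tripartite (m + 3) + n ^ 2 / 3 ≤ tripartite n + (m + 3) ^ 2 / 3 by
    rw [tripartite_add_three, sq_div_three_add_three] at H
    omega
  generalize m + 3 = w at hmn
  have mono : ∀ k, 5 ≤ k → ∀ l, k ≤ l →
      tripartite k + l ^ 2 / 3 ≤ tripartite l + k ^ 2 / 3 := fun k hk l hkl => by
    induction l, hkl using Nat.le_induction with
    | base => rfl
    | succ l hl ih =>
      have := tripartite_add_sq_div_three_succ l (by omega)
      omega
  by_cases hw : w < 9
  · have h9 := mono 9 (by norm_num) n hn
    have : tripartite w ≤ w ^ 2 / 3 := by interval_cases w <;> decide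
    have : tripartite 9 = 9 ^ 2 / 3 := by decide
    omega
  · exact mono w (by omega) n hmn

/-- Zykov's theorem on the number of triangles in `K₄`-free graphs. -/
theorem triangleSum_le (h : IsK4FreeIndicator A) (W : Finset V) :
    triangleSum A W ≤ 6 * (tripartite W.card : ℤ) := by
  induction hn : W.card using Nat.strong_induction_on generalizing W with
  | _ n ih =>
  by_cases ht : ∃ a ∈ W, ∃ b ∈ W, ∃ c ∈ W, A a b = 1 ∧ A a c = 1 ∧ A b c = 1
  · obtain ⟨a, ha, b, hb, c, hc, hab, hac, hbc⟩ := ht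
    obtain ⟨U, haU, hbU, hcU, rfl, hcard⟩ := exists_insert_three_of_mem ha hb hc
      (by rintro rfl; simp [h.diag] at hab) (by rintro rfl; simp [h.diag] at hac)
      (by rintro rfl; simp [h.diag] at hbc)
    rw [triangleSum_insert_three h haU hbU hcU hab hac hbc, ← hn, hcard, tripartite_add_three]
    have h1 := ih U.card (by omega) U rfl
    have h2 : ∑ x ∈ U, (A x a * A x b + A x a * A x c + A x b * A x c) ≤ ∑ x ∈ U, 1 :=
      Finset.sum_le_sum fun x _ => by
        have := h.sum_triangle_le hab hac hbc x
        rcases h.zero_or_one x a with h1 | h1 <;> rcases h.zero_or_one x b with h2 | h2 <;>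
          rcases h.zero_or_one x c with h3 | h3 <;> simp_all
    have h3 : ∑ x ∈ U, ∑ y ∈ U, A x y * (A x a * A y a + A x b * A y b + A x c * A y c) ≤
        pairSum A U := Finset.sum_le_sum fun x _ => Finset.sum_le_sum fun y _ => by
      rcases h.zero_or_one x y with h1 | h1
      · simp [h1]
      · simpa [h1] using h.common_triangle_le hab hac hbc h1
    have h4 := pairSum_le h U
    simp only [Finset.sum_const, nsmul_eq_mul] at h2
    push_cast at h1 h4 ⊢
    linarith
  · have : triangleSum A W = 0 := Finset.sum_eq_zero fun x hx => Finset.sum_eq_zero fun y hy =>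
      Finset.sum_eq_zero fun z hz => by
        have := h.zero_or_one x y
        have := h.zero_or_one x z
        have := h.zero_or_one y z
        by_contra hne
        refine ht ⟨x, hx, y, hy, z, hz, ?_⟩
        grind
    rw [this]
    positivity

/-- In a `K₄`-free graph on `W` with a triangle and all degrees at least two, the number of
triangles is small compared with the number of edges. -/
theorem triangleSum_le_pairSum_add (h : IsK4FreeIndicator A) (ha : a ∈ W) (hb : b ∈ W) (hc : c ∈ W)
    (hab : A a b = 1) (hac : A a c = 1) (hbc : A b c = 1)
    (hdeg : ∀ x ∈ W, 2 ≤ ∑ y ∈ W, A x y) :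
    ∃ m : ℕ, W.card = m + 3 ∧
      triangleSum A W + 6 * m + 12 ≤ 3 * pairSum A W + 6 * (tripartite m : ℤ) := by
  obtain ⟨U, haU, hbU, hcU, rfl, hcard⟩ := exists_insert_three_of_mem ha hb hc
    (by rintro rfl; simp [h.diag] at hab) (by rintro rfl; simp [h.diag] at hac)
    (by rintro rfl; simp [h.diag] at hbc)
  refine ⟨U.card, hcard, ?_⟩
  have nab : a ≠ b := by rintro rfl; simp [h.diag] at hab
  have nac : a ≠ c := by rintro rfl; simp [h.diag] at hac
  have nbc : b ≠ c := by rintro rfl; simp [h.diag] at hbc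
  rw [triangleSum_insert_three h haU hbU hcU hab hac hbc,
    pairSum_insert_three h haU hbU hcU hab hac hbc]
  have h1 := triangleSum_le h U
  have key : ∑ x ∈ U, (∑ y ∈ U, A x y * (A x a * A y a + A x b * A y b + A x c * A y c) +
      2 * (A x a * A x b + A x a * A x c + A x b * A x c)) + ∑ x ∈ U, 2 ≤
      ∑ x ∈ U, (∑ y ∈ U, A x y + 2 * (A x a + A x b + A x c)) := by
    rw [← Finset.sum_add_distrib]
    refine Finset.sum_le_sum fun x hx => ?_
    have hle : ∑ y ∈ U, A x y * (A x a * A y a + A x b * A y b + A x c * A y c) ≤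
        ∑ y ∈ U, A x y := Finset.sum_le_sum fun y _ => by
      rcases h.zero_or_one x y with h1 | h1
      · simp [h1]
      · simpa [h1] using h.common_triangle_le hab hac hbc h1
    have hx2 := hdeg x (by simp [hx])
    rw [Finset.sum_insert (by simp [nab, nac, haU]), Finset.sum_insert (by simp [nbc, hbU]),
      Finset.sum_insert hcU] at hx2
    have := h.sum_triangle_le hab hac hbc x
    rcases h.zero_or_one x a with h1 | h1 <;> rcases h.zero_or_one x b with h2 | h2 <;>
      rcases h.zero_or_one x c with h3 | h3 <;> simp only [h1, h2, h3, mul_zero, mul_one,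
      zero_mul, one_mul, add_zero, zero_add, Finset.sum_const_zero] at this hx2 hle ⊢ <;> linarith
  simp only [Finset.sum_add_distrib, ← Finset.mul_sum, Finset.sum_const, nsmul_eq_mul] at key ⊢
  unfold pairSum
  linarith

end

/-- A form of the deficiency version of Hall's theorem, obtained from a subset `X` of maximal
deficiency. -/
theorem exists_deficiency_decomposition {α β : Type*} [DecidableEq α] [DecidableEq β]
    (H : Finset α) (N : α → Finset β) :
    ∃ X ⊆ H, ∃ G : Finset β, ∃ r : {p // p ∈ G} → α, X.biUnion N ⊆ G ∧
      Function.Injective r ∧ (∀ p, r p ∈ H ∧ p.1 ∈ N (r p)) ∧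
        G.card + X.card = H.card + (X.biUnion N).card := by
  obtain ⟨X, hX, hmax⟩ := Finset.exists_max_image H.powerset
    (fun X => (X.card : ℤ) - (X.biUnion N).card) ⟨∅, by simp⟩
  rw [Finset.mem_powerset] at hX
  have hmax' : ∀ Y ⊆ H, (Y.card : ℤ) - (Y.biUnion N).card ≤ X.card - (X.biUnion N).card :=
    fun Y hY => hmax Y (Finset.mem_powerset.2 hY)
  obtain ⟨f, hf, hfN⟩ := (Finset.all_card_le_biUnion_card_iff_exists_injective
    (fun t : {t // t ∈ H \ X} => N t \ X.biUnion N)).1 (fun s => by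
      set Y : Finset α := s.map (Function.Embedding.subtype _) with hY
      have hYH : Y ⊆ H \ X := fun t ht => by
        obtain ⟨u, -, rfl⟩ := Finset.mem_map.1 ht
        exact u.2
      have hdisj : Disjoint X Y :=
        Finset.disjoint_left.2 fun t h1 h2 => (Finset.mem_sdiff.1 (hYH h2)).2 h1
      have h1 := hmax' (X ∪ Y) (Finset.union_subset hX fun t ht => (Finset.mem_sdiff.1 (hYH ht)).1)
      have h2 : (X ∪ Y).biUnion N =
          X.biUnion N ∪ s.biUnion fun t : {t // t ∈ H \ X} => N t \ X.biUnion N := by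
        ext p
        simp only [hY, Finset.mem_biUnion, Finset.mem_union, Finset.mem_map, Finset.mem_sdiff]
        constructor
        · rintro ⟨t, ht | ⟨u, hu, rfl⟩, hp⟩
          · exact Or.inl ⟨t, ht, hp⟩
          · by_cases hpX : ∃ t ∈ X, p ∈ N t
            · exact Or.inl hpX
            · exact Or.inr ⟨u, hu, hp, hpX⟩
        · rintro (⟨t, ht, hp⟩ | ⟨u, hu, hp, -⟩)
          · exact ⟨t, Or.inl ht, hp⟩
          · exact ⟨u, Or.inr ⟨u, hu, rfl⟩, hp⟩
      have h3 := Finset.card_union_le (X.biUnion N)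
        (s.biUnion fun t : {t // t ∈ H \ X} => N t \ X.biUnion N)
      rw [← h2] at h3
      rw [Finset.card_union_of_disjoint hdisj] at h1
      have h4 : Y.card = s.card := Finset.card_map _
      push_cast at h1
      omega)
  obtain ⟨g, hg, hgN⟩ := (Finset.all_card_le_biUnion_card_iff_exists_injective
    (fun p : {p // p ∈ X.biUnion N} => X.filter (p.1 ∈ N ·))).1 (fun s => by
      set S := s.biUnion fun p : {p // p ∈ X.biUnion N} => X.filter (p.1 ∈ N ·) with hS
      set Q : Finset β := s.map (Function.Embedding.subtype _) with hQ
      have hQX : Q ⊆ X.biUnion N := fun t ht => by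
        obtain ⟨u, -, rfl⟩ := Finset.mem_map.1 ht
        exact u.2
      have hSX : S ⊆ X := fun t ht => by
        obtain ⟨u, -, hu⟩ := Finset.mem_biUnion.1 ht
        exact (Finset.mem_filter.1 hu).1
      have h1 := hmax' (X \ S) (Finset.sdiff_subset.trans hX)
      have h2 : (X \ S).biUnion N ⊆ X.biUnion N \ Q := fun p hp => by
        obtain ⟨t, ht, hpt⟩ := Finset.mem_biUnion.1 hp
        obtain ⟨htX, htS⟩ := Finset.mem_sdiff.1 ht
        refine Finset.mem_sdiff.2 ⟨Finset.mem_biUnion.2 ⟨t, htX, hpt⟩, fun hpQ => htS ?_⟩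
        obtain ⟨u, hu, rfl⟩ := Finset.mem_map.1 hpQ
        exact Finset.mem_biUnion.2 ⟨u, hu, Finset.mem_filter.2 ⟨htX, hpt⟩⟩
      have h3 := Finset.card_le_card h2
      have h4 := Finset.card_sdiff_add_card_eq_card hSX
      have h5 := Finset.card_sdiff_add_card_eq_card hQX
      have h6 : Q.card = s.card := Finset.card_map _
      omega)
  set M : Finset β := Finset.univ.image f with hM
  have hMcard : M.card + X.card = H.card := by
    rw [hM, Finset.card_image_of_injective _ hf, Finset.card_univ, Fintype.card_coe,
      Finset.card_sdiff_add_card_eq_card hX]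
  have hdisj : Disjoint (X.biUnion N) M := Finset.disjoint_right.2 fun p hp => by
    obtain ⟨t, -, rfl⟩ := Finset.mem_image.1 hp
    exact (Finset.mem_sdiff.1 (hfN t)).2
  have hinv : ∀ p ∈ M, ∃ t : {t // t ∈ H \ X}, f t = p := fun p hp => by
    obtain ⟨t, -, h⟩ := Finset.mem_image.1 hp
    exact ⟨t, h⟩
  choose k hk using hinv
  have hpart : ∀ p : {p // p ∈ X.biUnion N ∪ M}, p.1 ∉ X.biUnion N → p.1 ∈ M := fun p h =>
    (Finset.mem_union.1 p.2).resolve_left h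
  have hg' := fun p => Finset.mem_filter.1 (hgN p)
  have hf' := fun t => Finset.mem_sdiff.1 (hfN t)
  refine ⟨X, hX, X.biUnion N ∪ M,
    fun p => if h : p.1 ∈ X.biUnion N then g ⟨p.1, h⟩ else (k p.1 (hpart p h)).1,
    Finset.subset_union_left, ?_, fun p => ?_, by
      rw [Finset.card_union_of_disjoint hdisj]; omega⟩
  · intro p q hpq
    by_cases hp : p.1 ∈ X.biUnion N <;> by_cases hq : q.1 ∈ X.biUnion N <;>
      simp only [hp, hq, dite_true, dite_false] at hpq
    · exact Subtype.ext (by simpa using hg hpq)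
    · exact absurd (hpq ▸ (hg' ⟨p.1, hp⟩).1) (Finset.mem_sdiff.1 (k q.1 (hpart q hq)).2).2
    · exact absurd (hpq ▸ (hg' ⟨q.1, hq⟩).1) (Finset.mem_sdiff.1 (k p.1 (hpart p hp)).2).2
    · exact Subtype.ext (by rw [← hk _ (hpart p hp), ← hk _ (hpart q hq), Subtype.ext hpq])
  · by_cases hp : p.1 ∈ X.biUnion N <;> simp only [hp, dite_true, dite_false]
    · exact ⟨hX (hg' ⟨p.1, hp⟩).1, (hg' ⟨p.1, hp⟩).2⟩
    · refine ⟨(Finset.mem_sdiff.1 (k p.1 (hpart p hp)).2).1, ?_⟩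
      have := (hf' (k p.1 (hpart p hp))).1
      rwa [hk] at this

section

variable {V : Type*} [DecidableEq V]

/-- The indicator of the adjacency relation of the graph with edge set `E`. -/
def edgeIndicator (E : Finset (Finset V)) (x y : V) : ℤ := if {x, y} ∈ E then 1 else 0

theorem edgeIndicator_eq_one {E : Finset (Finset V)} {x y : V} :
    edgeIndicator E x y = 1 ↔ {x, y} ∈ E := by
  unfold edgeIndicator
  split_ifs <;> simp_all

theorem isK4FreeIndicator_edgeIndicator {H E G : Finset (Finset V)}
    (hfree : ¬ HasBergeK4 H) (hE : ∀ e ∈ E, e.card = 2) (hEG : E ⊆ G)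
    (r : {p // p ∈ G} → Finset V) (hr : Function.Injective r)
    (hrH : ∀ p, r p ∈ H ∧ p.1 ⊆ r p) : IsK4FreeIndicator (edgeIndicator E) where
  zero_or_one x y := by
    unfold edgeIndicator
    split_ifs <;> simp
  symm x y := by
    unfold edgeIndicator
    rw [Finset.pair_comm]
  diag x := by
    unfold edgeIndicator
    rw [if_neg]
    intro h
    simpa using hE _ h
  k4_free a b c d hab hac had hbc hbd hcd := by
    rw [edgeIndicator_eq_one] at hab hac had hbc hbd hcd
    have ne : ∀ {x y}, {x, y} ∈ E → x ≠ y := by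
      rintro x y h rfl
      simpa using hE _ h
    have nab := ne hab
    have nac := ne hac
    have nad := ne had
    have nbc := ne hbc
    have nbd := ne hbd
    have ncd := ne hcd
    refine hfree ⟨a, b, c, d, r ⟨_, hEG hab⟩, r ⟨_, hEG hac⟩, r ⟨_, hEG had⟩, r ⟨_, hEG hbc⟩,
      r ⟨_, hEG hbd⟩, r ⟨_, hEG hcd⟩, nab, nac, nad, nbc, nbd, ncd, ?_, (hrH _).1, (hrH _).1,
      (hrH _).1, (hrH _).1, (hrH _).1, (hrH _).1, (hrH ⟨_, hEG hab⟩).2,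
      (hrH ⟨_, hEG hac⟩).2, (hrH ⟨_, hEG had⟩).2, (hrH ⟨_, hEG hbc⟩).2, (hrH ⟨_, hEG hbd⟩).2,
      (hrH ⟨_, hEG hcd⟩).2⟩
    have key : ∀ {x y z w : V}, (x ≠ z ∧ x ≠ w) ∨ (y ≠ z ∧ y ≠ w) →
        ∀ (h1 : {x, y} ∈ G) (h2 : {z, w} ∈ G), r ⟨_, h1⟩ ≠ r ⟨_, h2⟩ := by
      intro x y z w h h1 h2 he
      have he' : ({x, y} : Finset V) = {z, w} := congrArg Subtype.val (hr he)
      have hx : x ∈ ({z, w} : Finset V) := he' ▸ by simp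
      have hy : y ∈ ({z, w} : Finset V) := he' ▸ by simp
      simp only [Finset.mem_insert, Finset.mem_singleton] at hx hy
      tauto
    simp only [List.nodup_cons, List.mem_cons, List.not_mem_nil, or_false, not_or,
      not_false_eq_true, List.nodup_nil, and_true]
    refine ⟨⟨?_, ?_, ?_, ?_, ?_⟩, ⟨?_, ?_, ?_, ?_⟩, ⟨?_, ?_, ?_⟩, ⟨?_, ?_⟩, ?_⟩ <;>
      exact key (by tauto) _ _

theorem pairSum_edgeIndicator {E : Finset (Finset V)} {W : Finset V} (hE : ∀ e ∈ E, e.card = 2)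
    (hW : ∀ e ∈ E, e ⊆ W) : pairSum (edgeIndicator E) W = 2 * (E.card : ℤ) := by
  have h1 : pairSum (edgeIndicator E) W =
      (((W ×ˢ W).filter fun q => {q.1, q.2} ∈ E).card : ℤ) := by
    rw [Finset.card_filter, Finset.sum_product]
    push_cast
    rfl
  have h2 : ((W ×ˢ W).filter fun q => {q.1, q.2} ∈ E).card =
      ∑ e ∈ E, (((W ×ˢ W).filter fun q => {q.1, q.2} ∈ E).filter
        fun q => ({q.1, q.2} : Finset V) = e).card :=
    Finset.card_eq_sum_card_fiberwise fun q hq => (Finset.mem_filter.1 hq).2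
  rw [h1, h2, Finset.sum_congr rfl (g := fun _ => 2), Finset.sum_const]
  · simp [mul_comm]
  · intro e he
    obtain ⟨x, y, hxy, rfl⟩ := Finset.card_eq_two.1 (hE e he)
    have hx : x ∈ W := hW _ he (by simp)
    have hy : y ∈ W := hW _ he (by simp)
    have : (((W ×ˢ W).filter fun q => {q.1, q.2} ∈ E).filter
        fun q => ({q.1, q.2} : Finset V) = {x, y}) = {(x, y), (y, x)} := by
      ext ⟨u, v⟩
      simp only [Finset.mem_filter, Finset.mem_product, Finset.mem_insert, Finset.mem_singleton,
        Prod.mk.injEq]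
      constructor
      · rintro ⟨-, h⟩
        have hu : u ∈ ({x, y} : Finset V) := h ▸ by simp
        have hv : v ∈ ({x, y} : Finset V) := h ▸ by simp
        have hx : x ∈ ({u, v} : Finset V) := h ▸ by simp
        have hy : y ∈ ({u, v} : Finset V) := h ▸ by simp
        simp only [Finset.mem_insert, Finset.mem_singleton] at hu hv hx hy
        grind
      · rintro (⟨rfl, rfl⟩ | ⟨rfl, rfl⟩)
        · exact ⟨⟨⟨hx, hy⟩, he⟩, rfl⟩
        · exact ⟨⟨⟨hy, hx⟩, by rwa [Finset.pair_comm]⟩, Finset.pair_comm _ _⟩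
    rw [this, Finset.card_pair]
    simp [hxy]

theorem le_triangleSum_edgeIndicator {E X : Finset (Finset V)} {W : Finset V}
    (hX : ∀ t ∈ X, t.card = 3) (hXE : ∀ t ∈ X, t.powersetCard 2 ⊆ E) (hW : ∀ t ∈ X, t ⊆ W) :
    6 * (X.card : ℤ) ≤ triangleSum (edgeIndicator E) W := by
  set S := (W ×ˢ W ×ˢ W).filter fun q => {q.1, q.2.1} ∈ E ∧ {q.1, q.2.2} ∈ E ∧ {q.2.1, q.2.2} ∈ E
    with hS
  have h1 : triangleSum (edgeIndicator E) W = (S.card : ℤ) := by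
    rw [hS, Finset.card_filter, Finset.sum_product, triangleSum]
    simp only [Finset.sum_product]
    push_cast
    refine Finset.sum_congr rfl fun x _ => Finset.sum_congr rfl fun y _ =>
      Finset.sum_congr rfl fun z _ => ?_
    unfold edgeIndicator
    split_ifs <;> simp_all
  have h2 : ∑ t ∈ X, (S.filter fun q => ({q.1, q.2.1, q.2.2} : Finset V) = t).card ≤ S.card := by
    rw [← Finset.card_biUnion]
    · exact Finset.card_le_card (Finset.biUnion_subset.2 fun t _ => Finset.filter_subset _ _)
    · intro t _ u _ htu
      rw [Function.onFun, Finset.disjoint_left]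
      intro q h1 h2
      exact htu ((Finset.mem_filter.1 h1).2.symm.trans (Finset.mem_filter.1 h2).2)
  have h3 : ∑ t ∈ X, 6 ≤
      ∑ t ∈ X, (S.filter fun q => ({q.1, q.2.1, q.2.2} : Finset V) = t).card := by
    refine Finset.sum_le_sum fun t ht => ?_
    obtain ⟨x, y, z, hxy, hxz, hyz, rfl⟩ := Finset.card_eq_three.1 (hX t ht)
    have hx : x ∈ W := hW _ ht (by simp)
    have hy : y ∈ W := hW _ ht (by simp)
    have hz : z ∈ W := hW _ ht (by simp)
    have exy : {x, y} ∈ E := hXE _ ht (Finset.mem_powersetCard.2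
      ⟨by intro u; simp; tauto, Finset.card_pair hxy⟩)
    have exz : {x, z} ∈ E := hXE _ ht (Finset.mem_powersetCard.2
      ⟨by intro u; simp; tauto, Finset.card_pair hxz⟩)
    have eyz : {y, z} ∈ E := hXE _ ht (Finset.mem_powersetCard.2
      ⟨by intro u; simp; tauto, Finset.card_pair hyz⟩)
    have hsub : ({(x, y, z), (x, z, y), (y, x, z), (y, z, x), (z, x, y), (z, y, x)} :
        Finset (V × V × V)) ⊆ S.filter fun q => ({q.1, q.2.1, q.2.2} : Finset V) = {x, y, z} := by
      intro q hq
      simp only [Finset.mem_insert, Finset.mem_singleton] at hq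
      simp only [hS, Finset.mem_filter, Finset.mem_product]
      have c1 := Finset.pair_comm x y
      have c2 := Finset.pair_comm x z
      have c3 := Finset.pair_comm y z
      rcases hq with rfl | rfl | rfl | rfl | rfl | rfl <;>
        refine ⟨⟨⟨?_, ?_, ?_⟩, ?_, ?_, ?_⟩, ?_⟩ <;>
        first | assumption | rfl | (rw [Finset.pair_comm]; assumption) |
          (ext u; simp only [Finset.mem_insert, Finset.mem_singleton]; tauto)
    refine le_trans (le_of_eq ?_) (Finset.card_le_card hsub)
    simp [hxy, hxz, hyz, hxy.symm, hxz.symm, hyz.symm]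
  rw [h1]
  simp only [Finset.sum_const, smul_eq_mul] at h3
  omega

theorem two_le_sum_edgeIndicator {E : Finset (Finset V)} {W t : Finset V} (ht : t.card = 3)
    (htE : t.powersetCard 2 ⊆ E) (htW : t ⊆ W) {x : V} (hx : x ∈ t) :
    2 ≤ ∑ y ∈ W, edgeIndicator E x y := by
  have h1 : ∑ y ∈ t.erase x, edgeIndicator E x y ≤ ∑ y ∈ W, edgeIndicator E x y :=
    Finset.sum_le_sum_of_subset_of_nonneg ((Finset.erase_subset _ _).trans htW) fun y _ _ => by
      unfold edgeIndicator
      split_ifs <;> simp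
  have h2 : ∑ y ∈ t.erase x, edgeIndicator E x y = ∑ y ∈ t.erase x, 1 :=
    Finset.sum_congr rfl fun y hy => by
      obtain ⟨hyx, hyt⟩ := Finset.mem_erase.1 hy
      refine edgeIndicator_eq_one.2 (htE (Finset.mem_powersetCard.2
        ⟨?_, Finset.card_pair hyx.symm⟩))
      simp [Finset.insert_subset_iff, hx, hyt]
  rw [h2] at h1
  simpa [Finset.card_erase_of_mem hx, ht] using h1

theorem card_le_tripartite_of_nine_le [Fintype V] (hn : 9 ≤ Fintype.card V)
    {H : Finset (Finset V)} (hH3 : ∀ t ∈ H, t.card = 3) (hfree : ¬ HasBergeK4 H) :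
    H.card ≤ tripartite (Fintype.card V) := by
  obtain ⟨X, hXH, G, r, hNG, hr, hrH, hcard⟩ :=
    exists_deficiency_decomposition H (Finset.powersetCard 2)
  have hrH' : ∀ p, r p ∈ H ∧ p.1 ⊆ r p := fun p =>
    ⟨(hrH p).1, (Finset.mem_powersetCard.1 (hrH p).2).1⟩
  have hG2 : ∀ e ∈ G, e.card = 2 := fun e he => (Finset.mem_powersetCard.1 (hrH ⟨e, he⟩).2).2
  set E := X.biUnion (Finset.powersetCard 2) with hE
  have hE2 : ∀ e ∈ E, e.card = 2 := fun e he => hG2 e (hNG he)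
  have hGK := isK4FreeIndicator_edgeIndicator hfree hG2 subset_rfl r hr hrH'
  have hEK := isK4FreeIndicator_edgeIndicator hfree hE2 hNG r hr hrH'
  have hG : G.card ≤ Fintype.card V ^ 2 / 3 := by
    have h1 := pairSum_le hGK Finset.univ
    rw [pairSum_edgeIndicator hG2 fun e _ => Finset.subset_univ e, Finset.card_univ] at h1
    omega
  have hsmall := tripartite_sub_sq_div_three_le 6 _ hn hn
  have h6 : tripartite 6 = 8 := by decide
  rcases X.eq_empty_or_nonempty with hX | ⟨t, ht⟩
  · have hE0 : E = ∅ := by rw [hE, hX, Finset.biUnion_empty]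
    rw [hE0, hX, Finset.card_empty] at hcard
    omega
  · have hXE : ∀ t ∈ X, t.powersetCard 2 ⊆ E := fun t ht =>
      Finset.subset_biUnion_of_mem (Finset.powersetCard 2) ht
    have hX3 : ∀ t ∈ X, t.card = 3 := fun t ht => hH3 t (hXH ht)
    set W := X.biUnion id with hW
    have htW : ∀ t ∈ X, t ⊆ W := fun t ht => Finset.subset_biUnion_of_mem id ht
    have hEW : ∀ e ∈ E, e ⊆ W := fun e he => by
      obtain ⟨t, ht, het⟩ := Finset.mem_biUnion.1 he
      exact (Finset.mem_powersetCard.1 het).1.trans (htW t ht)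
    obtain ⟨x, y, z, hxy, hxz, hyz, rfl⟩ := Finset.card_eq_three.1 (hX3 t ht)
    have exy : edgeIndicator E x y = 1 := edgeIndicator_eq_one.2 (hXE _ ht
      (Finset.mem_powersetCard.2 ⟨by intro u; simp; tauto, Finset.card_pair hxy⟩))
    have exz : edgeIndicator E x z = 1 := edgeIndicator_eq_one.2 (hXE _ ht
      (Finset.mem_powersetCard.2 ⟨by intro u; simp; tauto, Finset.card_pair hxz⟩))
    have eyz : edgeIndicator E y z = 1 := edgeIndicator_eq_one.2 (hXE _ ht
      (Finset.mem_powersetCard.2 ⟨by intro u; simp; tauto, Finset.card_pair hyz⟩))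
    obtain ⟨m, hm, hle⟩ := triangleSum_le_pairSum_add (W := W) hEK (htW _ ht (by simp))
      (htW _ ht (by simp)) (htW _ ht (by simp)) exy exz eyz fun v hv => by
        obtain ⟨u, hu, hvu⟩ := Finset.mem_biUnion.1 hv
        exact two_le_sum_edgeIndicator (hX3 u hu) (hXE u hu) (htW u hu) hvu
    rw [pairSum_edgeIndicator hE2 hEW] at hle
    have h1 := le_triangleSum_edgeIndicator hX3 hXE htW
    have h2 := tripartite_sub_sq_div_three_le m _ (hm ▸ Finset.card_le_univ W) hn
    omega

end

/-- The `i`-th octal digit of `p`; a map `{0, …, 7} → {0, …, 7}` is encoded by its octal digits. -/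
def octalDigit (p i : ℕ) : ℕ := p / 8 ^ i % 8

/-- The image of the set of the first `n` bits of `m` under the map encoded by `p`. -/
def mapMask (p m : ℕ) : ℕ → ℕ
  | 0 => 0
  | i + 1 => bif m.testBit i then mapMask p m i ||| 2 ^ octalDigit p i else mapMask p m i

/-- Search for distinct masks in `L`, not occurring in `used`, which contain the given pairs. -/
def hasDistinctCover (L : List ℕ) : List (ℕ × ℕ) → List ℕ → Bool
  | [], _ => true
  | p :: ps, used => L.any fun t =>
      t.testBit p.1 && (t.testBit p.2 && (!used.elem t && hasDistinctCover L ps (t :: used)))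

/-- Check that `L` contains a Berge-`K₄` on the vertices `a`, `b`, `c`, `d`. -/
def isBergeK4 (L : List ℕ) (a b c d : ℕ) : Bool :=
  !(a == b) && (!(a == c) && (!(a == d) && (!(b == c) && (!(b == d) && (!(c == d) &&
    hasDistinctCover L [(a, b), (a, c), (a, d), (b, c), (b, d), (c, d)] [])))))

/-- Check that the permutation `p` of `{0, …, n - 1}` fixes `k` and maps `N` into `L`. -/
def isEmbedding (n k p : ℕ) (L N : List ℕ) : Bool :=
  mapMask p (2 ^ n - 1) n == 2 ^ n - 1 &&
    (mapMask p k n == k && N.all fun m => L.elem (mapMask p m n))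

/-- Check a certificate `c` for the system `L`: an even number encodes the vertices of a
Berge-`K₄` in `L`, an odd number encodes a system of `Ns` and its embedding into `L`. -/
def checkCertificate (n k : ℕ) (Ns : List (List ℕ)) (L : List ℕ) (c : ℕ) : Bool :=
  bif c % 2 == 0 then
    isBergeK4 L (octalDigit (c / 2) 0) (octalDigit (c / 2) 1) (octalDigit (c / 2) 2)
      (octalDigit (c / 2) 3)
  else
    match Ns[c / 2 / 8 ^ n]? with
    | none => false
    | some N => isEmbedding n k (c / 2 % 8 ^ n) L N

/-- Check the certificates for all extensions of `L` by one of the masks in the given list. -/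
def checkExtensions (n k : ℕ) (Ns : List (List ℕ)) (L : List ℕ) : List ℕ → List ℕ → Bool
  | [], _ => true
  | a :: as, cs => bif L.elem a then checkExtensions n k Ns L as cs else
      match cs with
      | [] => false
      | c :: cs => checkCertificate n k Ns (a :: L) c && checkExtensions n k Ns L as cs

/-- Check that every extension, by a mask from `as`, of a system in the first list contains
a Berge-`K₄` or a copy of a system in `Ns`. The systems contain at most `s` masks above `k`. -/
def checkLevel (n k s : ℕ) (as : List ℕ) (Ns : List (List ℕ)) :
    List (List ℕ) → List (List ℕ) → Bool
  | [], _ => true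
  | _ :: _, [] => false
  | L :: Ls, cs :: css => L.all (fun m => decide (m < 2 ^ n)) &&
      (decide ((L.filter fun m => k &&& m == k).length ≤ s) &&
        (checkExtensions n k Ns L as cs && checkLevel n k s as Ns Ls css))

theorem testBit_mapMask (p m n j : ℕ) :
    (mapMask p m n).testBit j = true ↔ ∃ i < n, m.testBit i = true ∧ octalDigit p i = j := by
  induction n with
  | zero => simp [mapMask]
  | succ n ih =>
    rw [mapMask]
    cases h : m.testBit n
    · simp only [cond_false, ih]
      constructor
      · rintro ⟨i, hi, h⟩
        exact ⟨i, by omega, h⟩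
      · rintro ⟨i, hi, h1, h2⟩
        refine ⟨i, lt_of_le_of_ne (by omega) ?_, h1, h2⟩
        rintro rfl
        simp [h] at h1
    · simp only [cond_true, Nat.testBit_or, Bool.or_eq_true, ih, Nat.testBit_two_pow,
        decide_eq_true_eq]
      constructor
      · rintro (⟨i, hi, h⟩ | rfl)
        · exact ⟨i, by omega, h⟩
        · exact ⟨n, by omega, h, rfl⟩
      · rintro ⟨i, hi, h1, h2⟩
        by_cases hin : i = n
        · exact Or.inr (hin ▸ h2)
        · exact Or.inl ⟨i, by omega, h1, h2⟩

theorem exists_of_hasDistinctCover {L : List ℕ} : ∀ {ps : List (ℕ × ℕ)} {used : List ℕ},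
    hasDistinctCover L ps used = true → ∃ es : List ℕ, es.Nodup ∧ (∀ t ∈ es, t ∉ used) ∧
      List.Forall₂ (fun p t => t ∈ L ∧ t.testBit p.1 = true ∧ t.testBit p.2 = true) ps es
  | [], _, _ => ⟨[], by simp⟩
  | p :: ps, used, h => by
    simp only [hasDistinctCover, List.any_eq_true, Bool.and_eq_true, Bool.not_eq_true',
      List.elem_eq_contains, List.contains_eq_mem, decide_eq_false_iff_not] at h
    obtain ⟨t, htL, h1, h2, h3, h4⟩ := h
    obtain ⟨es, hnd, hused, hes⟩ := exists_of_hasDistinctCover h4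
    refine ⟨t :: es, List.nodup_cons.2 ⟨fun h => hused t h List.mem_cons_self, hnd⟩, ?_,
      List.Forall₂.cons ⟨htL, h1, h2⟩ hes⟩
    intro u hu
    rcases List.mem_cons.1 hu with rfl | hu
    · exact h3
    · exact fun h => hused u hu (List.mem_cons_of_mem _ h)

section

variable {V : Type*} [DecidableEq V]

/-- The set of vertices encoded by the first `n` bits of `m`, for a labelling `e`. -/
def decodeMask (e : ℕ → V) (n m : ℕ) : Finset V :=
  ((Finset.range n).filter fun i => m.testBit i = true).image e

variable {e : ℕ → V} {n m : ℕ}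

theorem mem_decodeMask {v : V} : v ∈ decodeMask e n m ↔ ∃ i < n, m.testBit i = true ∧ e i = v := by
  simp [decodeMask, and_assoc]

theorem apply_mem_decodeMask (he : Set.InjOn e (Finset.range n)) {i : ℕ} (hi : i < n) :
    e i ∈ decodeMask e n m ↔ m.testBit i = true := by
  rw [mem_decodeMask]
  constructor
  · rintro ⟨j, hj, hm, h⟩
    rwa [← he (by simpa using hj) (by simpa using hi) h]
  · exact fun h => ⟨i, hi, h, rfl⟩

theorem lt_of_testBit_of_lt {i : ℕ} (hm : m < 2 ^ n) (h : m.testBit i = true) : i < n := by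
  by_contra hi
  rw [Nat.testBit_lt_two_pow (hm.trans_le (Nat.pow_le_pow_right (by norm_num) (not_lt.1 hi)))] at h
  exact Bool.false_ne_true h

theorem decodeMask_injOn (he : Set.InjOn e (Finset.range n)) {m m' : ℕ} (hm : m < 2 ^ n)
    (hm' : m' < 2 ^ n) (h : decodeMask e n m = decodeMask e n m') : m = m' := by
  refine Nat.eq_of_testBit_eq fun i => ?_
  by_cases hi : i < n
  · rw [Bool.eq_iff_iff, ← apply_mem_decodeMask he hi, ← apply_mem_decodeMask he hi, h]
  · rw [Bool.eq_iff_iff]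
    exact ⟨fun h => absurd (lt_of_testBit_of_lt hm h) hi,
      fun h => absurd (lt_of_testBit_of_lt hm' h) hi⟩

theorem exists_decodeMask_eq (he : Set.InjOn e (Finset.range n)) {t : Finset V}
    (ht : t ⊆ (Finset.range n).image e) :
    ∃ m < 2 ^ n, decodeMask e n m = t ∧
      ((Finset.range n).filter fun i => m.testBit i = true).card = t.card := by
  classical
  set f : Fin n → Bool := fun i => decide (e i ∈ t) with hf
  have hdec : decodeMask e n (Nat.ofBits f) = t := by
    ext v
    rw [mem_decodeMask]
    constructor
    · rintro ⟨i, hi, h, rfl⟩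
      rw [Nat.testBit_ofBits_lt _ _ hi] at h
      simpa [hf] using h
    · intro hv
      obtain ⟨i, hi, rfl⟩ := Finset.mem_image.1 (ht hv)
      rw [Finset.mem_range] at hi
      refine ⟨i, hi, ?_, rfl⟩
      rw [Nat.testBit_ofBits_lt _ _ hi]
      simpa [hf] using hv
  refine ⟨Nat.ofBits f, Nat.ofBits_lt_two_pow f, hdec, ?_⟩
  conv_rhs => rw [← hdec]
  rw [decodeMask, Finset.card_image_of_injOn (he.mono (by
    intro i hi
    exact (Finset.mem_filter.1 hi).1))]

theorem hasBergeK4_of_isBergeK4 {H : Finset (Finset V)} (he : Set.InjOn e (Finset.range n))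
    {L : List ℕ} (hlt : ∀ m ∈ L, m < 2 ^ n) (hL : ∀ m ∈ L, decodeMask e n m ∈ H) {a b c d : ℕ}
    (h : isBergeK4 L a b c d = true) : HasBergeK4 H := by
  simp only [isBergeK4, Bool.and_eq_true, Bool.not_eq_true', beq_eq_false_iff_ne] at h
  obtain ⟨hab, hac, had, hbc, hbd, hcd, h⟩ := h
  obtain ⟨es, hnd, -, hes⟩ := exists_of_hasDistinctCover h
  simp only [List.forall₂_cons_left_iff, List.forall₂_nil_left_iff] at hes
  obtain ⟨t1, _, ⟨m1, h1, h1'⟩, ⟨t2, _, ⟨m2, h2, h2'⟩, ⟨t3, _, ⟨m3, h3, h3'⟩, ⟨t4, _, ⟨m4, h4, h4'⟩,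
    ⟨t5, _, ⟨m5, h5, h5'⟩, ⟨t6, _, ⟨m6, h6, h6'⟩, rfl, rfl⟩, rfl⟩, rfl⟩, rfl⟩, rfl⟩, rfl⟩ := hes
  have ha := lt_of_testBit_of_lt (hlt _ m1) h1
  have hb := lt_of_testBit_of_lt (hlt _ m1) h1'
  have hc := lt_of_testBit_of_lt (hlt _ m2) h2'
  have hd := lt_of_testBit_of_lt (hlt _ m3) h3'
  have ne : ∀ {i j}, i < n → j < n → i ≠ j → e i ≠ e j := fun hi hj hij h =>
    hij (he (by simpa using hi) (by simpa using hj) h)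
  have sub : ∀ {i j t}, i < n → j < n → t.testBit i = true → t.testBit j = true →
      {e i, e j} ⊆ decodeMask e n t := fun hi hj h h' => by
    rw [Finset.insert_subset_iff, Finset.singleton_subset_iff]
    exact ⟨(apply_mem_decodeMask he hi).2 h, (apply_mem_decodeMask he hj).2 h'⟩
  refine ⟨e a, e b, e c, e d, _, _, _, _, _, _, ne ha hb hab, ne ha hc hac, ne ha hd had,
    ne hb hc hbc, ne hb hd hbd, ne hc hd hcd, ?_, hL _ m1, hL _ m2, hL _ m3, hL _ m4, hL _ m5,
    hL _ m6, sub ha hb h1 h1', sub ha hc h2 h2', sub ha hd h3 h3', sub hb hc h4 h4',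
    sub hb hd h5 h5', sub hc hd h6 h6'⟩
  refine List.Nodup.map_on (f := decodeMask e n) (fun x hx y hy hxy => ?_) hnd
  have hmem : ∀ x ∈ [t1, t2, t3, t4, t5, t6], x < 2 ^ n := by
    intro x hx
    simp only [List.mem_cons, List.not_mem_nil, or_false] at hx
    rcases hx with rfl | rfl | rfl | rfl | rfl | rfl <;> exact hlt _ ‹_›
  exact decodeMask_injOn he (hmem x hx) (hmem y hy) hxy

/-- The triple system `H` contains a copy on the vertex set `U`, with the set encoded by `k`
placed on `K`, of one of the systems in `Ls`. -/
def HasCopy (H : Finset (Finset V)) (U K : Finset V) (n k : ℕ) (Ls : List (List ℕ)) : Prop :=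
  ∃ e : ℕ → V, Set.InjOn e (Finset.range n) ∧ (Finset.range n).image e = U ∧
    decodeMask e n k = K ∧ ∃ L ∈ Ls, ∀ m ∈ L, decodeMask e n m ∈ H

/-- The number of members of `H` between the sets `K` and `U`. -/
def countBetween (H : Finset (Finset V)) (K U : Finset V) : ℕ :=
  (H.filter fun t => K ⊆ t ∧ t ⊆ U).card

theorem decodeMask_mapMask {p : ℕ} (hp : ∀ i < n, octalDigit p i < n) :
    decodeMask e n (mapMask p m n) = decodeMask (fun i => e (octalDigit p i)) n m := by
  ext v
  simp only [mem_decodeMask, testBit_mapMask]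
  constructor
  · rintro ⟨_, -, ⟨i, hi, hm, rfl⟩, rfl⟩
    exact ⟨i, hi, hm, rfl⟩
  · rintro ⟨i, hi, hm, rfl⟩
    exact ⟨_, hp i hi, ⟨i, hi, hm, rfl⟩, rfl⟩

theorem hasCopy_of_isEmbedding {H : Finset (Finset V)} {k p : ℕ} {L N : List ℕ}
    {Ns : List (List ℕ)} (he : Set.InjOn e (Finset.range n)) (hL : ∀ m ∈ L, decodeMask e n m ∈ H)
    (hN : N ∈ Ns) (h : isEmbedding n k p L N = true) :
    HasCopy H ((Finset.range n).image e) (decodeMask e n k) n k Ns := by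
  simp only [isEmbedding, Bool.and_eq_true, beq_iff_eq, List.all_eq_true, List.elem_eq_contains,
    List.contains_eq_mem, decide_eq_true_eq] at h
  obtain ⟨hfull, hk, hNL⟩ := h
  have hbit : ∀ j, (∃ i < n, octalDigit p i = j) ↔ j < n := fun j => by
    have := testBit_mapMask p (2 ^ n - 1) n j
    rw [hfull, Nat.testBit_two_pow_sub_one, decide_eq_true_eq] at this
    rw [this]
    refine exists_congr fun i => and_congr_right fun hi => ?_
    simp [Nat.testBit_two_pow_sub_one, hi]
  have himage : (Finset.range n).image (octalDigit p) = Finset.range n := by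
    ext j
    simp [hbit]
  have hlt : ∀ i < n, octalDigit p i < n := fun i hi => (hbit _).1 ⟨i, hi, rfl⟩
  have hinj : Set.InjOn (octalDigit p) (Finset.range n) :=
    Finset.injOn_of_card_image_eq (by rw [himage])
  refine ⟨fun i => e (octalDigit p i), ?_, ?_, ?_, N, hN, fun m hm => ?_⟩
  · exact he.comp hinj fun i hi => by simpa using hlt i (by simpa using hi)
  · conv_rhs => rw [← himage]
    rw [Finset.image_image]
    rfl
  · rw [← decodeMask_mapMask hlt, hk]
  · rw [← decodeMask_mapMask hlt]
    exact hL _ (hNL m hm)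

theorem hasCopy_of_checkCertificate {H : Finset (Finset V)} (hfree : ¬ HasBergeK4 H) {k c : ℕ}
    {L : List ℕ} {Ns : List (List ℕ)} (he : Set.InjOn e (Finset.range n))
    (hlt : ∀ m ∈ L, m < 2 ^ n) (hL : ∀ m ∈ L, decodeMask e n m ∈ H)
    (h : checkCertificate n k Ns L c = true) :
    HasCopy H ((Finset.range n).image e) (decodeMask e n k) n k Ns := by
  rw [checkCertificate] at h
  cases hc : c % 2 == 0 <;> rw [hc] at h
  · rw [cond_false] at h
    split at h
    · exact absurd h Bool.false_ne_true
    · next N hN => exact hasCopy_of_isEmbedding he hL (List.mem_of_getElem? hN) h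
  · exact absurd (hasBergeK4_of_isBergeK4 he hlt hL h) hfree

theorem exists_checkCertificate_of_checkExtensions {k : ℕ} {L : List ℕ} {Ns : List (List ℕ)} :
    ∀ {as cs : List ℕ}, checkExtensions n k Ns L as cs = true → ∀ a ∈ as, a ∉ L →
      ∃ c, checkCertificate n k Ns (a :: L) c = true
  | [], _, _, a, ha, _ => absurd ha List.not_mem_nil
  | b :: as, cs, h, a, ha, haL => by
    rw [checkExtensions.eq_def] at h
    dsimp only at h
    cases hb : L.elem b <;> rw [hb] at h
    · rw [cond_false] at h
      split at h
      · exact absurd h Bool.false_ne_true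
      · rw [Bool.and_eq_true] at h
        rcases List.mem_cons.1 ha with rfl | ha
        · exact ⟨_, h.1⟩
        · exact exists_checkCertificate_of_checkExtensions h.2 a ha haL
    · rcases List.mem_cons.1 ha with rfl | ha
      · exact absurd (by simpa using hb) haL
      · exact exists_checkCertificate_of_checkExtensions h a ha haL

theorem checkExtensions_of_checkLevel {k s : ℕ} {as : List ℕ} {Ns : List (List ℕ)} :
    ∀ {Ls css : List (List ℕ)}, checkLevel n k s as Ns Ls css = true → ∀ L ∈ Ls,
      (∀ m ∈ L, m < 2 ^ n) ∧ (L.filter fun m => k &&& m == k).length ≤ s ∧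
        ∃ cs, checkExtensions n k Ns L as cs = true
  | [], _, _, L, hL => absurd hL List.not_mem_nil
  | M :: Ls, [], h, _, _ => absurd h Bool.false_ne_true
  | M :: Ls, cs :: css, h, L, hL => by
    simp only [checkLevel, Bool.and_eq_true, List.all_eq_true, decide_eq_true_eq] at h
    rcases List.mem_cons.1 hL with rfl | hL
    · exact ⟨h.1, h.2.1, cs, h.2.2.1⟩
    · exact checkExtensions_of_checkLevel h.2.2.2 L hL

theorem HasCopy.step {H : Finset (Finset V)} (hH3 : ∀ t ∈ H, t.card = 3) (hfree : ¬ HasBergeK4 H)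
    {U K : Finset V} {k s : ℕ} {as : List ℕ} {Ls css Ns : List (List ℕ)}
    (h : HasCopy H U K n k Ls) (hs : s < countBetween H K U) (hk : k < 2 ^ n)
    (has : ∀ m < 2 ^ n, ((Finset.range n).filter fun i => m.testBit i = true).card = 3 →
      k &&& m = k → m ∈ as)
    (hcheck : checkLevel n k s as Ns Ls css = true) : HasCopy H U K n k Ns := by
  obtain ⟨e, he, rfl, rfl, L, hL, hLH⟩ := h
  obtain ⟨hlt, hlen, cs, hcs⟩ := checkExtensions_of_checkLevel hcheck L hL
  set D : Finset (Finset V) :=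
    ((L.filter fun m => k &&& m == k).map (decodeMask e n)).toFinset with hD
  have hDcard : D.card ≤ s :=
    (List.toFinset_card_le _).trans (by rw [List.length_map]; exact hlen)
  obtain ⟨t, htF, htD⟩ := Finset.exists_mem_notMem_of_card_lt_card (hDcard.trans_lt hs)
  obtain ⟨htH, hKt, htU⟩ := Finset.mem_filter.1 htF
  obtain ⟨m, hm, rfl, hcard⟩ := exists_decodeMask_eq he htU
  have hkm : k &&& m = k := by
    refine Nat.eq_of_testBit_eq fun i => ?_
    rw [Nat.testBit_and]
    cases hi : k.testBit i
    · rfl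
    · have hin := lt_of_testBit_of_lt hk hi
      rw [(apply_mem_decodeMask he hin).1 (hKt ((apply_mem_decodeMask he hin).2 hi)), Bool.and_true]
  have hmL : m ∉ L := fun h => htD (List.mem_toFinset.2 (List.mem_map.2
    ⟨m, List.mem_filter.2 ⟨h, by simpa using hkm⟩, rfl⟩))
  obtain ⟨c, hc⟩ := exists_checkCertificate_of_checkExtensions hcs m
    (has m hm (hcard.trans (hH3 _ htH)) hkm) hmL
  refine hasCopy_of_checkCertificate hfree he ?_ ?_ hc
  · intro x hx
    rcases List.mem_cons.1 hx with rfl | hx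
    exacts [hm, hlt x hx]
  · intro x hx
    rcases List.mem_cons.1 hx with rfl | hx
    exacts [htH, hLH x hx]

end

/-- The triples on six points. -/
def sixTriples : List ℕ :=
    [7, 11, 13, 14, 19, 21, 22, 25, 26, 28, 35, 37, 38, 41, 42, 44, 49, 50, 52, 56]

/-- The triples on seven points. -/
def sevenTriples : List ℕ :=
    [7, 11, 13, 14, 19, 21, 22, 25, 26, 28, 35, 37, 38, 41, 42, 44, 49, 50, 52, 56, 67, 69, 70,
    73, 74, 76, 81, 82, 84, 88, 97, 98, 100, 104, 112]

/-- The triples on seven points which contain the last point. -/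
def sevenLinks : List ℕ :=
    [67, 69, 70, 73, 74, 76, 81, 82, 84, 88, 97, 98, 100, 104, 112]

/-- The triples on eight points which contain the last point. -/
def eightLinks : List ℕ :=
    [131, 133, 134, 137, 138, 140, 145, 146, 148, 152, 161, 162, 164, 168, 176, 193, 194, 196,
    200, 208, 224]

/-- Representatives of the Berge-`K₄`-free systems of 0 triples on six points. -/
def sixSystems0 : List (List ℕ) :=
    [[]]

/-- Representatives of the Berge-`K₄`-free systems of 1 triple on six points. -/
def sixSystems1 : List (List ℕ) :=
    [[7]]

/-- Certificate that one more triple on six points extends `sixSystems0` to `sixSystems1`. -/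
def sixSystemsCert0 : List (List ℕ) :=
    [[363793, 362897, 361889, 360867, 354833, 353825, 352803, 345649, 344627, 336437, 289425,
    288417, 287395, 280241, 279219, 271029, 214721, 213699, 205509, 139975]]

/-- Representatives of the Berge-`K₄`-free systems of 2 triples on six points. -/
def sixSystems2 : List (List ℕ) :=
    [[7, 11], [7, 25], [7, 56]]

/-- Certificate that one more triple on six points extends `sixSystems1` to `sixSystems2`. -/
def sixSystemsCert1 : List (List ℕ) :=
    [[363793, 363681, 363555, 356625, 356513, 356387, 888081, 888067, 887941, 292113, 292001,
    291875, 830737, 830723, 830597, 766225, 766211, 766085, 1412369]]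

/-- Representatives of the Berge-`K₄`-free systems of 3 triples on six points. -/
def sixSystems3 : List (List ℕ) :=
    [[7, 11, 13], [7, 11, 19], [7, 11, 21], [7, 11, 28], [7, 11, 49], [7, 11, 52], [7, 25, 42]]

/-- Certificate that one more triple on six points extends `sixSystems2` to `sixSystems3`. -/
def sixSystemsCert2 : List (List ℕ) :=
    [[363793, 363779, 888081, 1412369, 1412355, 1411473, 1411459, 1936657, 830737, 1355025, 1355011,
    1354129, 1354115, 1879313, 2460945, 2460931, 2985233, 2984337], [1411473, 1410465, 1936419,
    1403409, 1402401, 1929251, 1918023, 1910855, 2389265, 2389153, 2913315, 2242097, 3509521,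
    3509409, 2241985, 3502353, 3502241, 2765895], [2984337, 2983329, 2982307, 2976273, 2975265,
    2974243, 2765895, 2757831, 2692423, 2910865, 2909857, 2908835, 2764887, 2756823, 2691415,
    2763865, 2755801, 2690393]]

/-- Representatives of the Berge-`K₄`-free systems of 4 triples on six points. -/
def sixSystems4 : List (List ℕ) :=
    [[7, 11, 13, 14], [7, 11, 13, 19], [7, 11, 13, 22], [7, 11, 13, 49], [7, 11, 13, 50], [7, 11,
    19, 28], [7, 11, 19, 35], [7, 11, 19, 37], [7, 11, 19, 44], [7, 11, 21, 25], [7, 11, 21,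
    26], [7, 11, 21, 38], [7, 11, 21, 41], [7, 11, 21, 42], [7, 11, 21, 44], [7, 11, 21, 56],
    [7, 11, 28, 44], [7, 11, 28, 49], [7, 11, 28, 52], [7, 11, 52, 56], [7, 25, 42, 52]]

/-- Certificate that one more triple on six points extends `sixSystems3` to `sixSystems4`. -/
def sixSystemsCert3 : List (List ℕ) :=
    [[363793, 888081, 887969, 1412369, 886961, 1411473, 1410465, 830737, 830625, 1355025, 829617,
    1354129, 1353121, 1936657, 2460945, 2460833, 2459825], [888081, 888067, 880913, 880899,
    872849, 872835, 2985233, 3509521, 4033809, 4033795, 4032913, 4032899, 4558097, 4024849,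
    4024835, 4550929, 4542865], [887969, 1412355, 880913, 1405061, 5082385, 5606673, 5599393,
    3976465, 3911841, 6130961, 6655249, 7179537, 7703825, 6647969, 7696545, 7172257, 8228113],
    [1410465, 1409443, 2985233, 5599393, 5599267, 5591217, 5591091, 4500753, 7646481, 7646467,
    7645585, 7645571, 8752401, 9276689, 9276675, 9800977, 9800081], [1936657, 2460931, 4024849,
    6647969, 7696419, 6639793, 7688243, 9276689, 3959441, 6583457, 7631907, 6575281, 7623731,
    9219345, 8602713, 9644121, 9579609], [2460833, 2460707, 4550929, 7172257, 7172131, 8227217,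
    8227203, 9800977, 4486417, 7107745, 7107619, 8169873, 8169859, 9743633, 9644121, 9636057,
    10325265], [6130065, 7701921, 7643555, 7687361, 8218145, 9269283, 7512263, 9250887, 7621715,
    9204897, 8151715, 7504983, 9177303, 9057729, 9048531, 10849553, 8004295]]

/-- Representatives of the Berge-`K₄`-free systems of 5 triples on six points. -/
def sixSystems5 : List (List ℕ) :=
    [[7, 11, 13, 14, 19], [7, 11, 13, 14, 49], [7, 11, 13, 19, 21], [7, 11, 13, 19, 22], [7, 11, 13,
    19, 28], [7, 11, 13, 19, 35], [7, 11, 13, 19, 37], [7, 11, 13, 19, 38], [7, 11, 13, 19, 44],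
    [7, 11, 13, 19, 49], [7, 11, 13, 19, 50], [7, 11, 13, 19, 52], [7, 11, 13, 22, 26], [7, 11,
    13, 22, 38], [7, 11, 13, 22, 42], [7, 11, 13, 22, 49], [7, 11, 13, 22, 50], [7, 11, 13, 22,
    56], [7, 11, 13, 49, 50], [7, 11, 13, 50, 52], [7, 11, 19, 28, 35], [7, 11, 19, 28, 37], [7,
    11, 19, 28, 44], [7, 11, 19, 37, 41], [7, 11, 19, 37, 42], [7, 11, 19, 37, 44], [7, 11, 19,
    37, 56], [7, 11, 19, 44, 52], [7, 11, 21, 25, 38], [7, 11, 21, 25, 44], [7, 11, 21, 26, 28],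
    [7, 11, 21, 26, 38], [7, 11, 21, 26, 44], [7, 11, 21, 26, 49], [7, 11, 21, 26, 52], [7, 11,
    21, 38, 56], [7, 11, 21, 41, 49], [7, 11, 21, 41, 50], [7, 11, 21, 41, 52], [7, 11, 21, 42,
    52], [7, 11, 21, 44, 50], [7, 11, 21, 44, 56], [7, 11, 28, 44, 49]]

/-- Certificate that one more triple on six points extends `sixSystems4` to `sixSystems5`. -/
def sixSystemsCert4 : List (List ℕ) :=
    [[363793, 363681, 363555, 362673, 362547, 361525, 306449, 306337, 306211, 305329, 305203,
    304181, 888081, 888067, 887941, 886919], [363793, 1412369, 1936657, 1411473, 1935761,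
    2460945, 2985233, 3509521, 4033809, 3508625, 4032913, 4558097, 5082385, 5606673, 6130961,
    6130065], [363555, 1936657, 1936545, 2459825, 6655249, 6655137, 3976465, 3976353, 7179537,
    4499633, 7703825, 7703713, 8228113, 8752401, 8752289, 9276689], [888081, 5082385, 5082273,
    8228113, 5081265, 8227217, 8226209, 5025041, 5024929, 8170769, 5023921, 8169873, 8168865,
    9800977, 9800865, 9799857], [888067, 5606673, 6130849, 8752401, 6129841, 8751505, 9274785,
    5549329, 6073505, 8695057, 6072497, 8694161, 9217441, 9800977, 10325265, 10324369],
    [2460945, 2460931, 2453777, 2453763, 2445713, 2445699, 10849553, 11373841, 11373827,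
    11372945, 11372931, 11898129, 11364881, 11364867, 11890961, 11882897], [2985233, 2985219,
    2978065, 2978051, 2970001, 2969987, 10849553, 2913553, 2913539, 2905489, 2905475, 10792209,
    2840081, 2840067, 10727697, 10662289], [3509521, 4033795, 3502353, 4026627, 5067153,
    5591427, 11373841, 2913553, 7107717, 12422417, 12946705, 13470993, 12415249, 12939537,
    13463825, 13995281], [4558097, 4558083, 6123793, 6123779, 6115729, 6115715, 11898129,
    10792209, 13470993, 13470979, 13470097, 13470083, 13986321, 13986307, 14519569, 14518673],
    [1410465, 6655235, 1403409, 6647941, 6639751, 6630665, 12365073, 12300449, 15043857,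
    12234929, 15042961, 15568145, 12168513, 15560865, 15033889, 15025713], [2460833, 2459699,
    1927697, 6647829, 6639751, 16092433, 12889361, 13349025, 16616721, 16615811, 13283379,
    17141009, 17665297, 17664387, 18189585, 18188675], [4033697, 3976227, 4026641, 3911701,
    15043857, 16616721, 16609441, 3962115, 3904645, 16559363, 14986499, 16544803, 16494725,
    16487445, 14921861, 18713873], [3507617, 7703811, 5075217, 8745093, 12234929, 16615811,
    17658017, 5002641, 12293281, 16559363, 8672391, 17585329, 19238161, 19762449, 20286737,
    20228497], [4557985, 4499507, 5599505, 8744981, 15042961, 13283379, 18182305, 5526915,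
    13341857, 14986499, 8672391, 18109491, 20279457, 20206643, 20811025, 20752771], [4031905,
    7703587, 6123793, 8220805, 15568145, 17141009, 17655301, 11316497, 12817569, 16544803,
    17585329, 18109491, 19755169, 21335313, 20132933, 21859601], [6129057, 9276675, 6122001,
    9269381, 15025713, 18188675, 18179589, 13937937, 13873313, 18713873, 20228497, 20752771,
    21859601, 20162081, 21852321, 20686341], [7177633, 7176611, 11898129, 17655301, 17654293,
    17647111, 17646103, 11840785, 17589893, 17588885, 17581703, 17580695, 22383889, 22383875,
    9508405, 9508391], [8226209, 9273763, 11364881, 16606725, 17133603, 16598535, 17125427,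
    13920913, 19690657, 21277955, 19682481, 21277059, 22383889, 22234201, 21586265, 21578201],
    [8750497, 8749475, 11890961, 13216837, 13151429, 18171399, 18170391, 14462225, 20131925,
    20123861, 21801361, 21801347, 9508405, 21586265, 21521753, 10032553], [10323361, 10322339,
    14510609, 20686341, 20685333, 20620807, 20619799, 10032553, 14445201, 20678277, 20677269,
    20612743, 20611735, 10031531, 14248025, 14182617], [18712977, 21333409, 21275043, 21326353,
    18703905, 21209621, 21143751, 21078329, 21260931, 21202565, 18637475, 21115527, 21005627,
    21057161, 20991515, 18490055]]

/-- Representatives of the Berge-`K₄`-free systems of 6 triples on six points. -/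
def sixSystems6 : List (List ℕ) :=
    [[7, 11, 13, 14, 19, 35], [7, 11, 13, 14, 19, 49], [7, 11, 13, 14, 19, 52], [7, 11, 13, 14, 49,
    50], [7, 11, 13, 19, 21, 35], [7, 11, 13, 19, 21, 38], [7, 11, 13, 19, 22, 35], [7, 11, 13,
    19, 22, 37], [7, 11, 13, 19, 28, 35], [7, 11, 13, 19, 28, 44], [7, 11, 13, 19, 35, 49], [7,
    11, 13, 19, 35, 50], [7, 11, 13, 19, 35, 52], [7, 11, 13, 19, 37, 49], [7, 11, 13, 19, 37,
    50], [7, 11, 13, 19, 37, 56], [7, 11, 13, 19, 38, 49], [7, 11, 13, 19, 38, 50], [7, 11, 13,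
    19, 38, 52], [7, 11, 13, 19, 38, 56], [7, 11, 13, 19, 44, 49], [7, 11, 13, 19, 44, 50], [7,
    11, 13, 19, 44, 52], [7, 11, 13, 19, 49, 50], [7, 11, 13, 22, 26, 38], [7, 11, 13, 22, 38,
    49], [7, 11, 13, 22, 38, 56], [7, 11, 13, 22, 42, 49], [7, 11, 13, 22, 42, 50], [7, 11, 13,
    22, 42, 52], [7, 11, 13, 22, 50, 52], [7, 11, 19, 28, 35, 44], [7, 11, 19, 28, 37, 44], [7,
    11, 19, 28, 37, 56], [7, 11, 19, 37, 41, 49], [7, 11, 19, 37, 41, 50], [7, 11, 19, 37, 41,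
    52], [7, 11, 19, 37, 42, 52], [7, 11, 19, 37, 44, 52], [7, 11, 19, 37, 44, 56], [7, 11, 21,
    25, 38, 42], [7, 11, 21, 25, 38, 56], [7, 11, 21, 26, 38, 41], [7, 11, 21, 26, 38, 50], [7,
    11, 21, 26, 38, 56], [7, 11, 21, 26, 49, 50], [7, 11, 21, 26, 49, 56], [7, 11, 21, 26, 52,
    56], [7, 11, 21, 42, 52, 56], [7, 11, 28, 44, 49, 50]]

/-- Certificate that one more triple on six points extends `sixSystems5` to `sixSystems6`. -/
def sixSystemsCert5 : List (List ℕ) :=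
    [[1412, 1440, 1076, 1440, 1076, 363793, 1412, 1440, 1076, 1440, 1076, 888081, 888067, 1412369,
    1411473], [888081, 887969, 1412131, 886961, 1411123, 1410101, 830737, 830625, 1354787,
    829617, 1353779, 1352757, 1936657, 1936545, 1935537], [278, 322, 4130, 4512, 2608, 2460945,
    2460833, 2985233, 418, 180, 306, 4130, 4130, 4130, 4512], [1328, 322, 4130, 1440, 2608,
    3509521, 4033809, 4026627, 1076, 1440, 1076, 4130, 4130, 4116, 4512], [404, 4482, 4512,
    3586, 4512, 4558097, 2098, 2182, 3106, 3204, 5082385, 4482, 4482, 4512, 4512], [363793,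
    2460945, 3509521, 2460049, 3508625, 4558097, 2403601, 3452177, 2402705, 3451281, 4500753,
    5606673, 6130961, 6655249, 6654353], [278, 2460833, 4033809, 418, 180, 306, 2403601,
    3976353, 418, 180, 306, 7179537, 7703825, 7646369, 8228113], [1328, 2985233, 4026627, 1076,
    1440, 1076, 3452177, 3976353, 1076, 1440, 1076, 8752401, 9276689, 9800977, 10325265], [404,
    2098, 2182, 3106, 3204, 5082385, 4500753, 2098, 2182, 3106, 3204, 10849553, 11373841,
    11898129, 11897233], [888081, 546, 196, 562, 198, 4482, 5606673, 7179537, 8752401, 7178641,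
    8751505, 10849553, 12422417, 4130, 4482], [888067, 1092, 1092, 1094, 1094, 4228, 6130961,
    7703825, 9276689, 7702929, 9275793, 11373841, 12422417, 4228, 4230], [1412369, 2114, 322,
    4130, 4512, 2608, 6655249, 7646369, 9800977, 8227217, 10324369, 11898129, 4130, 4130, 4512],
    [3232, 3344, 3344, 3232, 3344, 3344, 3344, 12946705, 3232, 12945809, 3344, 4512, 4514, 4514,
    4500], [363555, 4026627, 4026501, 5081265, 12946705, 12946593, 3962115, 3961989, 5023921,
    12889361, 12889249, 13470993, 12260899, 12260885, 13995281], [3232, 3344, 3344, 3232,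
    12945809, 3344, 3344, 3344, 12889361, 3232, 3344, 14519569, 15043857, 15568145, 15509905],
    [1412131, 546, 546, 562, 4512, 2608, 8695057, 8694945, 13470993, 10791089, 14519569,
    14519457, 4130, 4130, 4512], [887843, 1092, 1064, 4116, 1588, 1350, 9219345, 9743521,
    12260899, 11839665, 15043857, 15568033, 4116, 16092433, 4500], [1409443, 4512, 2608, 3616,
    3618, 3618, 10267921, 10267809, 13995281, 11315377, 15509905, 15508897, 4512, 4514, 4514],
    [1936657, 12422417, 546, 196, 562, 198, 4482, 12365073, 674, 212, 690, 214, 5506, 4130,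
    4482], [1936419, 1092, 2114, 16092433, 4130, 1588, 2610, 1108, 2130, 16035089, 5154, 1716,
    2738, 4130, 4514], [4558097, 4558083, 4550929, 4550915, 4542865, 4542851, 6583569, 6583555,
    6575505, 6575491, 16616721, 6510097, 6510083, 16609553, 16601489], [2098, 278, 2114, 322,
    4130, 4130, 6583569, 13399173, 418, 180, 17141009, 4130, 4130, 17133841, 17665297],
    [5082385, 5082371, 2610, 2608, 3618, 3616, 16616721, 17141009, 17140995, 17140113, 17140099,
    17656337, 17656323, 2608, 3616], [418, 180, 7172369, 9269507, 7164305, 9261443, 418,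
    2386577, 12874885, 12866695, 418, 18189585, 18713873, 19238161, 19237265], [1076, 1076,
    7696657, 8745219, 8737169, 7688579, 1076, 3435153, 12874773, 12866695, 1076, 18706705,
    18698627, 19762449, 19761539], [2098, 278, 7581857, 9793795, 418, 180, 17141009, 4486417,
    5006421, 418, 180, 19230993, 19755281, 20286737, 20811025], [8228113, 10325251, 8220945,
    10318083, 10834321, 11358595, 17665297, 6580881, 13923461, 19237265, 19761539, 20811025,
    19229201, 19753475, 20803857], [11898129, 11898115, 11890961, 11890947, 4514, 4512, 2608,
    16545041, 20286737, 20286723, 20810129, 20810115, 20802065, 20802051, 4512], [2098, 278,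
    1092, 168, 4228, 3330, 9204995, 9147525, 19050673, 21335313, 3330, 18984257, 4228, 21328033,
    21859601], [2983329, 3330, 4512, 4512, 3106, 3616, 3330, 18591905, 3330, 18526385, 3106,
    4512, 4514, 4512, 4484], [4496, 3344, 4512, 3344, 4496, 3204, 4354, 3344, 4496, 4496, 4512,
    4512, 4496, 4512, 4514], [1286, 2224, 1568, 1568, 4256, 3344, 8680707, 9671813, 22383889,
    19043379, 3344, 4256, 22908177, 4256, 23432465], [3330, 3344, 4512, 3344, 3616, 3616, 3204,
    19633313, 3344, 3106, 19567667, 4512, 4514, 4512, 4514], [4130, 4228, 4024849, 4228,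
    12928519, 4130, 18642193, 4130, 4228, 22907267, 16953395, 4484, 23956753, 4130, 24481041],
    [4354, 4256, 4228, 4256, 4130, 4512, 19705105, 4354, 4256, 23431555, 20623411, 4512, 4130,
    24480131, 25005329], [10325153, 10267683, 10318097, 10203157, 21859601, 23432465, 23425185,
    10253571, 10196101, 23375107, 21802243, 23360547, 23310469, 23303189, 21737605], [7177633,
    15043843, 7170577, 15036549, 6960689, 22907267, 22898181, 7098001, 7025313, 22850819,
    14963847, 22824583, 22751881, 14890249, 14823819], [8226209, 14519555, 8743441, 15560725,
    562, 198, 4482, 8670865, 674, 212, 15488023, 5154, 22751881, 5154, 4482], [7701921,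
    15568131, 10842385, 11772997, 19047985, 23431555, 16886853, 674, 9122437, 338, 5154,
    24401073, 14890249, 5154, 24710489], [11373729, 11837747, 11366673, 11772101, 21858705,
    20623411, 20556869, 1108, 2130, 21263395, 5154, 24925235, 5154, 24851525, 25529617],
    [10323361, 14519331, 10316305, 14512149, 4514, 1588, 2610, 1108, 2130, 22311971, 5154,
    23347863, 5154, 23274153, 4514], [9799073, 15507875, 4512, 4512, 3616, 3618, 3616, 17607953,
    19629701, 23360547, 16877655, 20482263, 4512, 4514, 4512], [13469089, 13992355, 17656337,
    326, 2608, 452, 3616, 17590929, 692, 5536, 692, 5536, 26053905, 5536, 5536]]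

/-- Representatives of the Berge-`K₄`-free systems of 7 triples on six points. -/
def sixSystems7 : List (List ℕ) :=
    [[7, 11, 13, 14, 19, 35, 49], [7, 11, 13, 14, 19, 35, 52], [7, 11, 13, 14, 19, 49, 50], [7, 11,
    13, 19, 21, 35, 37], [7, 11, 13, 19, 21, 35, 38], [7, 11, 13, 19, 22, 37, 38], [7, 11, 13,
    19, 28, 35, 44], [7, 11, 13, 22, 26, 38, 42], [7, 11, 21, 25, 38, 42, 52]]

/-- Certificate that one more triple on six points extends `sixSystems6` to `sixSystems7`. -/
def sixSystemsCert6 : List (List ℕ) :=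
    [[1412, 1440, 1076, 1440, 1076, 1412, 1440, 1076, 1440, 1076, 363793, 363779, 888081, 887185],
    [1412, 1440, 1076, 1440, 4482, 363793, 1412, 1440, 1076, 1440, 1076, 1412369, 4130, 4482],
    [1412, 1440, 1076, 1440, 2608, 888081, 1412, 1440, 1076, 1440, 1076, 4130, 4130, 4512],
    [1412369, 546, 196, 562, 198, 4482, 1355025, 674, 212, 690, 214, 5506, 4130, 4482], [278,
    322, 4130, 4512, 2608, 1936657, 2460945, 418, 180, 306, 4130, 4130, 4130, 4512], [278, 322,
    4130, 4512, 2608, 2460945, 2460833, 418, 180, 306, 4130, 4130, 4130, 4512], [1328, 322,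
    4130, 1440, 2608, 2403601, 2339075, 1076, 1440, 1076, 4130, 4130, 4116, 4512], [278, 322,
    4130, 1440, 2608, 2403601, 2985233, 1076, 1440, 306, 4130, 4130, 4116, 4512], [404, 4482,
    4512, 3586, 4512, 2098, 2182, 3106, 3204, 3509521, 4482, 4482, 4512, 4512], [404, 4482,
    4512, 3586, 4512, 3509521, 2098, 2182, 3106, 3204, 4482, 4482, 4512, 4512], [363793, 546,
    196, 562, 198, 4482, 674, 212, 690, 214, 5506, 218641, 4130, 4482], [363779, 1092, 1092,
    1094, 1094, 4228, 1108, 1108, 1110, 1110, 5252, 218641, 4228, 4230], [888081, 2114, 322,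
    4130, 4512, 2608, 2130, 338, 5154, 5536, 2736, 4130, 4130, 4512], [278, 546, 196, 418, 180,
    306, 674, 338, 418, 180, 306, 5154, 4130, 4482], [278, 1092, 1092, 418, 180, 306, 1108, 212,
    418, 180, 306, 5154, 5154, 5506], [278, 4482, 4512, 418, 180, 306, 5536, 5536, 418, 180,
    306, 4482, 4482, 4512], [1328, 546, 196, 1076, 1440, 4482, 674, 674, 1076, 1440, 2736, 5154,
    4130, 4482], [1328, 1092, 1568, 1076, 1440, 4256, 1108, 1066, 1076, 1440, 1366, 5140, 4256,
    5524], [1328, 1344, 322, 1076, 1440, 2608, 2074, 2130, 1076, 1440, 2738, 4130, 4130, 4512],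
    [1328, 4482, 4512, 1076, 1440, 3616, 5536, 2736, 1076, 1440, 3746, 4482, 4482, 4512], [404,
    546, 196, 562, 198, 4482, 674, 692, 5536, 692, 5536, 5506, 4130, 4482], [404, 2098, 1092,
    3106, 1094, 4228, 1108, 5506, 1716, 3714, 1716, 5506, 5538, 5538], [404, 2098, 322, 4130,
    4512, 2608, 5424, 2736, 2738, 2512, 2514, 4130, 4130, 4512], [1412369, 546, 196, 562, 198,
    4482, 218641, 674, 212, 690, 214, 5506, 4130, 4482], [3232, 3344, 3344, 3232, 3344, 3344,
    3344, 3232, 4033809, 3344, 4512, 4514, 4514, 4500], [887843, 546, 546, 562, 4512, 2608, 674,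
    674, 690, 5536, 2736, 4130, 4130, 4512], [885155, 4512, 2608, 3616, 3618, 3618, 5536, 2736,
    3744, 3746, 3746, 4512, 4514, 4514], [3232, 3344, 3344, 3232, 4512, 3344, 3344, 3344, 5536,
    3232, 3344, 4130, 4130, 4512], [3232, 3344, 3344, 3232, 1588, 3344, 3344, 3344, 1716, 3232,
    3344, 4116, 5300, 4500], [3232, 3344, 3344, 3232, 2246, 3344, 3344, 3344, 2738, 3232, 3344,
    4130, 5538, 4514], [1412131, 1092, 2114, 4116, 1588, 1350, 1696, 1360, 1250851, 5154, 1716,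
    2738, 4116, 4500], [3509521, 3509507, 2610, 2608, 3618, 3616, 5538, 5536, 5538, 5536, 5666,
    5664, 2608, 3616], [2098, 278, 2610, 322, 4130, 4130, 5536, 5536, 418, 180, 4130, 4130,
    2608, 3616], [4514, 278, 4514, 322, 4130, 4130, 5536, 5536, 418, 180, 4512, 4130, 4130,
    4512], [418, 180, 546, 196, 562, 198, 418, 1862289, 3961989, 3953799, 418, 3888265, 4130,
    4482], [418, 180, 5154, 5252, 5520, 5520, 418, 2386577, 5252, 5520, 418, 3888265, 5154,
    5506], [418, 180, 5188, 322, 4130, 4130, 418, 5154, 674, 5154, 418, 4130, 4130, 5636],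
    [1076, 5280, 5648, 322, 4130, 4130, 5536, 5252, 5280, 5154, 5536, 4130, 4130, 5666], [2098,
    278, 2114, 322, 418, 180, 2608, 3437841, 3433557, 418, 180, 4130, 4130, 4512], [2098, 278,
    4514, 4512, 418, 180, 3616, 5536, 5536, 418, 180, 5536, 5538, 4512], [2098, 2224, 1092,
    4496, 4228, 3330, 1108, 5506, 5140, 3330, 5140, 4228, 4558097, 4557201], [2098, 4484, 1092,
    4482, 4228, 3330, 5636, 5506, 3714, 4557201, 3330, 5506, 4228, 4548129], [3106, 2224, 1568,
    1568, 4256, 3344, 674, 674, 5154, 3344, 4256, 4482, 4256, 4482], [4272, 4272, 1568, 1568,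
    4256, 3344, 1728, 5648, 4272, 4272, 3344, 4256, 4256, 4496], [4496, 4496, 1568, 1568, 4256,
    3344, 1712, 5520, 4496, 4496, 3344, 4256, 4496, 4256], [4130, 4228, 2976273, 4228, 4272,
    4130, 1728, 4130, 4228, 4272, 4272, 4484, 4130, 4496], [4130, 4228, 4118, 4228, 4496, 4130,
    4178, 4130, 4228, 4496, 4496, 4484, 4496, 4130], [4496, 4256, 4228, 4256, 4130, 4512, 5666,
    5680, 4256, 4496, 4496, 4512, 4130, 4496], [5538, 4512, 5666, 4496, 4539953, 3600, 4512,
    5680, 5680, 4481699, 5154, 4512, 5154, 4496], [4496, 4496, 5664, 326, 2608, 452, 3616, 5664,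
    692, 5536, 692, 5536, 5536, 5536]]

/-- Representatives of the Berge-`K₄`-free systems of 8 triples on six points. -/
def sixSystems8 : List (List ℕ) :=
    [[7, 11, 13, 14, 19, 35, 49, 50], [7, 11, 21, 25, 38, 42, 52, 56]]

/-- Certificate that one more triple on six points extends `sixSystems7` to `sixSystems8`. -/
def sixSystemsCert7 : List (List ℕ) :=
    [[1412, 1440, 1076, 1440, 4482, 1412, 1440, 1076, 1440, 5506, 363793, 4130, 4482], [1412, 1440,
    1076, 1440, 2608, 1412, 1440, 1076, 1440, 2736, 4130, 4130, 4512], [1412, 1440, 1076, 1440,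
    4482, 363793, 1412, 1440, 1076, 1440, 5506, 4130, 4482], [278, 322, 4130, 4512, 2608, 338,
    418, 180, 306, 4130, 4130, 4130, 4512], [278, 322, 4130, 4512, 2608, 338, 418, 180, 306,
    4130, 4130, 4130, 4512], [278, 1344, 4130, 1440, 2608, 1696, 1076, 1440, 306, 4130, 4130,
    1344, 4512], [404, 4482, 4512, 3586, 4512, 5506, 5536, 3714, 5536, 4482, 4482, 4512, 4512],
    [3232, 3344, 3344, 3232, 3344, 3344, 3344, 3232, 3344, 4512, 4514, 4514, 4500], [5538, 4512,
    5652, 4496, 4228, 3330, 5636, 5506, 5140, 3330, 5140, 4228, 888081]]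

/-- Certificate that one more triple on six points extends `sixSystems8` to a Berge-`K₄`. -/
def sixSystemsCert8 : List (List ℕ) :=
    [[1412, 1440, 1076, 1440, 4482, 1412, 1440, 1076, 1440, 5506, 4130, 4482], [5538, 4512, 5652,
    4496, 4228, 3330, 5636, 5506, 5140, 3330, 5140, 4228]]

/-- Representatives of the Berge-`K₄`-free systems on seven points with 1 triple through the last
point and 8 others. -/
def sevenOverEight1 : List (List ℕ) :=
    [[7, 11, 13, 14, 19, 35, 49, 50, 67], [7, 11, 21, 25, 38, 42, 52, 56, 67]]

/-- Certificate that one more triple through the last of seven points extends `sixSystems8` to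
`sevenOverEight1`. -/
def sevenOverEightCert0 : List (List ℕ) :=
    [[3509521, 1412, 1440, 1076, 1440, 1076, 5648, 5648, 4130, 4482, 5648, 5648, 5154, 5506, 5256],
    [7703825, 7696545, 7631907, 7688369, 7623731, 3330, 7679297, 4228, 7550021, 7484487, 5140,
    7605587, 7540949, 7475415, 7408985]]

/-- Representatives of the Berge-`K₄`-free systems on seven points with 2 triples through the last
point and 8 others. -/
def sevenOverEight2 : List (List ℕ) :=
    [[7, 11, 21, 25, 38, 42, 52, 56, 67, 69], [7, 11, 21, 25, 38, 42, 52, 56, 67, 81], [7, 11, 21,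
    25, 38, 42, 52, 56, 67, 84], [7, 11, 21, 25, 38, 42, 52, 56, 67, 112]]

/-- Certificate that one more triple through the last of seven points extends `sevenOverEight1` to
`sevenOverEight2`. -/
def sevenOverEightCert1 : List (List ℕ) :=
    [[1412, 1440, 1076, 1440, 1076, 5648, 5648, 4130, 4482, 5648, 5648, 5154, 5506, 5256], [3509521,
    3452163, 3508625, 3451267, 3330, 7703825, 4228, 11898129, 11897233, 5140, 7646467, 11840771,
    11839875, 16092433]]

/-- Representatives of the Berge-`K₄`-free systems on seven points with 3 triples through the last
point and 8 others. -/
def sevenOverEight3 : List (List ℕ) :=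
    [[7, 11, 21, 25, 38, 42, 52, 56, 67, 81, 98]]

/-- Certificate that one more triple through the last of seven points extends `sevenOverEight2` to
`sevenOverEight3`. -/
def sevenOverEightCert2 : List (List ℕ) :=
    [[354, 6178, 6178, 3330, 6178, 4228, 6178, 6530, 5140, 6178, 6178, 6530, 6660], [802, 228, 818,
    230, 3330, 4228, 6178, 6530, 5140, 3509521, 6178, 6530, 3484993], [1376, 354, 6178, 6178,
    3330, 6178, 4228, 6660, 5140, 6178, 6660, 6704, 6660], [836, 6660, 838, 6704, 3330, 3484993,
    4228, 4868, 4912, 5140, 3411283, 6660, 6704]]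

/-- Representatives of the Berge-`K₄`-free systems on seven points with 4 triples through the last
point and 8 others. -/
def sevenOverEight4 : List (List ℕ) :=
    [[7, 11, 21, 25, 38, 42, 52, 56, 67, 81, 98, 112]]

/-- Certificate that one more triple through the last of seven points extends `sevenOverEight3` to
`sevenOverEight4`. -/
def sevenOverEightCert3 : List (List ℕ) :=
    [[802, 228, 818, 230, 3330, 4228, 6178, 6530, 5140, 6178, 6530, 3509521]]

/-- Representatives of the Berge-`K₄`-free systems on seven points with 1 triple through the last
point and 7 others. -/
def sevenOverSeven1 : List (List ℕ) :=
    [[7, 11, 13, 14, 19, 35, 49, 67], [7, 11, 13, 14, 19, 35, 49, 81], [7, 11, 13, 14, 19, 35, 49,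
    82], [7, 11, 13, 14, 19, 35, 49, 112], [7, 11, 13, 14, 19, 35, 52, 67], [7, 11, 13, 14, 19,
    35, 52, 84], [7, 11, 13, 14, 19, 35, 52, 112], [7, 11, 13, 14, 19, 49, 50, 67], [7, 11, 13,
    14, 19, 49, 50, 81], [7, 11, 13, 14, 19, 49, 50, 97], [7, 11, 13, 14, 19, 49, 50, 112], [7,
    11, 13, 19, 21, 35, 37, 67], [7, 11, 13, 19, 21, 35, 37, 70], [7, 11, 13, 19, 21, 35, 38,
    67], [7, 11, 13, 19, 21, 35, 38, 69], [7, 11, 13, 19, 21, 35, 38, 70], [7, 11, 13, 19, 22,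
    37, 38, 67], [7, 11, 13, 19, 28, 35, 44, 67], [7, 11, 13, 19, 28, 35, 44, 76], [7, 11, 13,
    22, 26, 38, 42, 70], [7, 11, 21, 25, 38, 42, 52, 67], [7, 11, 21, 25, 38, 42, 52, 73], [7,
    11, 21, 25, 38, 42, 52, 88]]

/-- Certificate that one more triple through the last of seven points extends `sixSystems7` to
`sevenOverSeven1`. -/
def sevenOverSevenCert0 : List (List ℕ) :=
    [[3509521, 1412, 1440, 1076, 1440, 1076, 7703825, 11898129, 4130, 4482, 7646481, 11840785, 5154,
    5506, 16092433], [20286737, 1412, 1440, 1076, 1440, 1076, 4130, 4130, 24481041, 4512, 5154,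
    5154, 24423697, 5536, 28675345], [32869649, 1412, 1440, 1076, 1440, 1076, 37063953,
    37063939, 4130, 4482, 41258257, 41258243, 5154, 5506, 45452561], [49646865, 49646753,
    53841169, 418, 180, 306, 4130, 4130, 4130, 4512, 5154, 5154, 5154, 5536, 5664], [58035473,
    62229777, 66424081, 418, 180, 306, 4130, 4130, 4130, 4512, 5154, 5154, 5140, 5536, 5664],
    [70618385, 70560929, 70496291, 1076, 1440, 306, 4130, 4130, 1344, 4512, 5154, 5280, 5154,
    5536, 5648], [74812689, 2098, 2182, 3106, 3204, 79006993, 4482, 4482, 4512, 4512, 5506,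
    5506, 5536, 5536, 5664], [3344, 3344, 83201297, 3232, 83200401, 3344, 4512, 4514, 4514,
    4500, 5536, 5538, 5538, 5524, 5652], [87395601, 87388321, 87323683, 91589905, 91532547,
    3330, 91582625, 4228, 91467909, 95784209, 5140, 91517987, 91460629, 95726851, 95662213]]

/-- Representatives of the Berge-`K₄`-free systems on seven points with 2 triples through the last
point and 7 others. -/
def sevenOverSeven2 : List (List ℕ) :=
    [[7, 11, 13, 14, 19, 35, 49, 67, 81], [7, 11, 13, 14, 19, 35, 49, 67, 82], [7, 11, 13, 14, 19,
    35, 49, 67, 112], [7, 11, 13, 14, 19, 35, 49, 81, 82], [7, 11, 13, 14, 19, 35, 52, 67, 84],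
    [7, 11, 13, 14, 19, 35, 52, 67, 112], [7, 11, 13, 14, 19, 49, 50, 67, 81], [7, 11, 13, 14,
    19, 49, 50, 67, 97], [7, 11, 13, 14, 19, 49, 50, 67, 112], [7, 11, 13, 14, 19, 49, 50, 81,
    82], [7, 11, 13, 19, 21, 35, 37, 67, 69], [7, 11, 13, 19, 21, 35, 37, 67, 70], [7, 11, 13,
    19, 21, 35, 38, 67, 69], [7, 11, 13, 19, 21, 35, 38, 67, 70], [7, 11, 13, 19, 21, 35, 38,
    69, 70], [7, 11, 13, 19, 22, 37, 38, 67, 69], [7, 11, 13, 19, 28, 35, 44, 67, 76], [7, 11,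
    13, 22, 26, 38, 42, 70, 74], [7, 11, 21, 25, 38, 42, 52, 67, 69], [7, 11, 21, 25, 38, 42,
    52, 67, 73], [7, 11, 21, 25, 38, 42, 52, 67, 81], [7, 11, 21, 25, 38, 42, 52, 67, 84], [7,
    11, 21, 25, 38, 42, 52, 67, 88], [7, 11, 21, 25, 38, 42, 52, 67, 112], [7, 11, 21, 25, 38,
    42, 52, 73, 74], [7, 11, 21, 25, 38, 42, 52, 73, 81], [7, 11, 21, 25, 38, 42, 52, 73, 84],
    [7, 11, 21, 25, 38, 42, 52, 73, 88], [7, 11, 21, 25, 38, 42, 52, 73, 100], [7, 11, 21, 25,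
    38, 42, 52, 73, 104], [7, 11, 21, 25, 38, 42, 52, 73, 112], [7, 11, 21, 25, 38, 42, 52, 88,
    104]]

/-- Certificate that one more triple through the last of seven points extends `sevenOverSeven1` to
`sevenOverSeven2`. -/
def sevenOverSevenCert1 : List (List ℕ) :=
    [[1412, 1440, 1076, 1440, 1076, 3509521, 7703825, 4130, 4482, 3452177, 7646481, 5154, 5506,
    11898129], [3509521, 1412, 1440, 1076, 1440, 1076, 16092433, 4130, 4482, 706, 706, 5154,
    5506, 4738], [7703825, 1412, 1440, 1076, 1440, 1076, 16092433, 4130, 4482, 5648, 5648, 5154,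
    5506, 5256], [11898129, 1412, 1440, 1076, 1440, 1076, 5634, 5634, 4130, 4482, 5634, 5634,
    5154, 5506], [1412, 1440, 1076, 1440, 1076, 4130, 4130, 20286737, 4512, 5154, 5154,
    20229393, 5536, 24481041], [20286737, 1412, 1440, 1076, 1440, 1076, 4130, 4130, 4512, 5154,
    5154, 2752, 5536, 4768], [24481041, 1412, 1440, 1076, 1440, 1076, 4130, 4130, 5664, 4512,
    5154, 5154, 5664, 5536], [1412, 1440, 1076, 1440, 1076, 28675345, 28675331, 4130, 4482,
    32869649, 32869635, 5154, 5506, 37063953], [28675345, 1412, 1440, 1076, 1440, 1076,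
    41258257, 4130, 4482, 706, 4738, 5154, 5506, 4738], [32869649, 1412, 1440, 1076, 1440, 1076,
    5186, 5186, 4130, 4482, 5634, 5154, 5506, 5634], [37063953, 1412, 1440, 1076, 1440, 1076,
    5648, 5648, 4130, 4482, 5634, 5648, 5154, 5506], [45452561, 49646865, 418, 180, 306, 4130,
    4130, 4130, 4512, 5154, 5154, 5154, 5536, 5664], [49646865, 49646753, 418, 180, 306, 4130,
    4130, 4130, 4512, 5154, 5154, 5154, 5536, 5664], [53841169, 58035473, 418, 180, 306, 4130,
    4130, 4130, 4512, 5154, 5154, 5140, 5536, 5664], [53841169, 62229777, 418, 180, 306, 4130,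
    4130, 4130, 4512, 5154, 5154, 5140, 5536, 5664], [58035473, 62229777, 418, 180, 306, 4130,
    4130, 4130, 4512, 5154, 5154, 1360, 5536, 5664], [66424081, 66416899, 1076, 1440, 306, 4130,
    4130, 1344, 4512, 5154, 5280, 5154, 5536, 5648], [2098, 2182, 3106, 3204, 70618385, 4482,
    4482, 4512, 4512, 5506, 5506, 5536, 5536, 5664], [70618385, 2098, 2182, 3106, 3204, 4482,
    4482, 4512, 4512, 5506, 5506, 5536, 5536, 5664], [3344, 3344, 3232, 74812689, 3344, 4512,
    4514, 4514, 4500, 5536, 5538, 5538, 5524, 5652], [79006993, 78949635, 83201297, 83143939,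
    3330, 87395601, 4228, 91589905, 95784209, 5140, 87338243, 91532547, 95726851, 99978513],
    [83201297, 87388321, 91517987, 104172817, 3330, 108367121, 4228, 112561425, 116755729, 5140,
    112489507, 120950033, 125144337, 129338641], [95784209, 95776929, 99906595, 116755729,
    125086979, 3330, 116748449, 4228, 125022341, 5140, 129266723, 129209365, 133532945,
    133525665]]

/-- Representatives of the Berge-`K₄`-free systems on seven points with 3 triples through the last
point and 7 others. -/
def sevenOverSeven3 : List (List ℕ) :=
    [[7, 11, 21, 25, 38, 42, 52, 67, 81, 98], [7, 11, 21, 25, 38, 42, 52, 67, 81, 112], [7, 11, 21,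
    25, 38, 42, 52, 73, 100, 104]]

/-- Certificate that one more triple through the last of seven points extends `sevenOverSeven2` to
`sevenOverSeven3`. -/
def sevenOverSevenCert2 : List (List ℕ) :=
    [[1412, 1440, 1076, 1440, 6530, 4866, 4130, 4482, 706, 706, 5154, 5506, 4738], [1412, 1440,
    1076, 1440, 6544, 4866, 4130, 4482, 5648, 5648, 5154, 5506, 4944], [1412, 1440, 1076, 1440,
    1076, 5634, 5634, 4130, 4482, 5634, 5634, 5154, 5506], [4194, 1412, 1440, 1076, 1440, 6530,
    4130, 4482, 706, 706, 5154, 5506, 4738], [1412, 1440, 1076, 1440, 2864, 4130, 4130, 4512,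
    5154, 5154, 2752, 5536, 4768], [1412, 1440, 1076, 1440, 1076, 4130, 4130, 5664, 4512, 5154,
    5154, 5664, 5536], [1412, 1440, 1076, 1440, 6530, 4866, 4130, 4482, 706, 4738, 5154, 5506,
    4738], [1412, 1440, 1076, 1440, 6530, 5186, 5186, 4130, 4482, 5634, 5154, 5506, 5634],
    [1412, 1440, 1076, 1440, 1076, 5648, 5648, 4130, 4482, 5634, 5648, 5154, 5506], [4194, 1412,
    1440, 1076, 1440, 6530, 4130, 4482, 706, 4738, 5154, 5506, 4738], [354, 418, 180, 306, 4130,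
    4130, 4130, 4512, 5154, 5154, 5154, 5536, 5664], [354, 418, 180, 306, 4130, 4130, 4130,
    4512, 5154, 5154, 5154, 5536, 5664], [354, 418, 180, 306, 4130, 4130, 4130, 4512, 5154,
    5154, 6178, 5536, 5664], [1376, 418, 180, 306, 4130, 4130, 4130, 4512, 5154, 5154, 1360,
    5536, 5664], [1824, 418, 180, 306, 4130, 4130, 4130, 4512, 5154, 5154, 6178, 5536, 5664],
    [354, 1076, 1440, 306, 4130, 4130, 1344, 4512, 5154, 5280, 5154, 5536, 5648], [6530, 6560,
    3842, 6560, 4482, 4482, 4512, 4512, 5506, 5506, 5536, 5536, 5664], [3344, 3344, 3232, 3344,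
    4512, 4514, 4514, 4500, 5536, 5538, 5538, 5524, 5652], [354, 6178, 6178, 3330, 6178, 4228,
    6178, 6530, 5140, 6178, 6178, 6530, 6660], [802, 228, 3842, 3330, 6530, 4228, 6178, 6530,
    5140, 6530, 6178, 6530, 6704], [802, 228, 818, 230, 3330, 4228, 6178, 6530, 5140, 3509521,
    6178, 6530, 7703825], [1376, 354, 6178, 6178, 3330, 6178, 4228, 6660, 5140, 6178, 6660,
    6704, 6660], [6530, 6530, 3842, 3842, 3330, 6530, 4228, 4868, 5140, 6530, 6660, 6704, 6704],
    [836, 6660, 838, 6704, 3330, 7703825, 4228, 4868, 4912, 5140, 7646467, 6660, 6704], [3170,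
    802, 228, 3330, 6530, 4228, 6178, 6530, 5140, 6530, 6178, 6530, 6704], [818, 836, 6194, 482,
    3330, 4228, 4868, 4912, 5140, 6194, 6660, 6704, 6662], [802, 836, 354, 6178, 3330, 836,
    4228, 6660, 5140, 6178, 6660, 6704, 6660], [3170, 836, 6530, 3842, 3330, 4912, 4228, 4868,
    5140, 6530, 6660, 6704, 6704], [802, 3502241, 354, 6178, 3330, 836, 4228, 360, 6660, 5140,
    6178, 11898129, 6660], [3170, 7696545, 6530, 3842, 3330, 3176, 4228, 6704, 3904, 5140, 6530,
    11898129, 6704], [6704, 836, 6660, 6704, 3330, 4912, 4228, 4868, 4912, 5140, 5938, 6660,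
    6704], [6592, 6592, 6834, 3904, 3922, 3330, 3680, 4228, 4948, 5140, 5938, 5956, 5958]]

/-- Representatives of the Berge-`K₄`-free systems on seven points with 4 triples through the last
point and 7 others. -/
def sevenOverSeven4 : List (List ℕ) :=
    [[7, 11, 21, 25, 38, 42, 52, 67, 81, 98, 112]]

/-- Certificate that one more triple through the last of seven points extends `sevenOverSeven3` to
`sevenOverSeven4`. -/
def sevenOverSevenCert3 : List (List ℕ) :=
    [[802, 228, 818, 230, 3330, 4228, 6178, 6530, 5140, 6178, 6530, 3509521], [802, 228, 818, 230,
    3330, 4228, 6178, 6530, 5140, 3509521, 6178, 6530], [802, 3502241, 354, 6178, 3330, 836,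
    4228, 360, 6660, 5140, 6178, 6660]]

/-- Certificate that one more triple through the last of seven points extends `sevenOverSeven4` to
a Berge-`K₄`. -/
def sevenOverSevenCert4 : List (List ℕ) :=
    [[802, 228, 818, 230, 3330, 4228, 6178, 6530, 5140, 6178, 6530]]

/-- Certificate that one more triple extends `sevenOverEight4` to a Berge-`K₄`. -/
def sevenFullCert : List (List ℕ) :=
    [[418, 4512, 5652, 4496, 4228, 3330, 5636, 5506, 5140, 3330, 5140, 4228, 802, 228, 818, 230,
    3330, 4228, 6178, 6530, 5140, 6178, 6530]]

/-- Representatives of the Berge-`K₄`-free systems on eight points with 1 triple through the last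
point and 12 others. -/
def eightSystems1 : List (List ℕ) :=
    [[7, 11, 19, 37, 41, 49, 70, 74, 82, 100, 104, 112, 131], [7, 11, 19, 37, 41, 49, 70, 74, 82,
    100, 104, 112, 133]]

/-- Certificate that one more triple through the last of eight points extends `sevenOverEight4` to
`eightSystems1`. -/
def eightSystemsCert0 : List (List ℕ) :=
    [[32296209, 65850641, 65391875, 65849745, 65390979, 3330, 32099649, 4228, 63819017, 63818121,
    5140, 31509843, 63229211, 63228315, 29936985, 65825553, 65366787, 6178, 6530, 63793929,
    63204123]]

/-- Representatives of the Berge-`K₄`-free systems on eight points with 2 triples through the last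
point and 12 others. -/
def eightSystems2 : List (List ℕ) :=
    [[7, 11, 19, 37, 41, 49, 70, 74, 82, 100, 104, 112, 131, 133], [7, 11, 19, 37, 41, 49, 70, 74,
    82, 100, 104, 112, 131, 161], [7, 11, 19, 37, 41, 49, 70, 74, 82, 100, 104, 112, 131, 164],
    [7, 11, 19, 37, 41, 49, 70, 74, 82, 100, 104, 112, 131, 224], [7, 11, 19, 37, 41, 49, 70,
    74, 82, 100, 104, 112, 133, 134], [7, 11, 19, 37, 41, 49, 70, 74, 82, 100, 104, 112, 133,
    137], [7, 11, 19, 37, 41, 49, 70, 74, 82, 100, 104, 112, 133, 138], [7, 11, 19, 37, 41, 49,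
    70, 74, 82, 100, 104, 112, 133, 196], [7, 11, 19, 37, 41, 49, 70, 74, 82, 100, 104, 112,
    133, 200]]

/-- Certificate that one more triple through the last of eight points extends `eightSystems1` to
`eightSystems2`. -/
def eightSystemsCert1 : List (List ℕ) :=
    [[32869649, 32410883, 32868753, 32409987, 418, 32860689, 32401923, 4130, 4482, 66424081, 5252,
    99978513, 99977617, 99969553, 6164, 65965315, 99519747, 99518851, 99510787, 133532945],
    [32869649, 167087377, 200641809, 234196241, 418, 200634641, 234189073, 4130, 4482, 32607569,
    5252, 166825297, 233934161, 233926993, 6164, 99126627, 267750673, 301305105, 301297937,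
    97029483]]

/-- Representatives of the Berge-`K₄`-free systems on eight points with 3 triples through the last
point and 12 others. -/
def eightSystems3 : List (List ℕ) :=
    [[7, 11, 19, 37, 41, 49, 70, 74, 82, 100, 104, 112, 131, 161, 194], [7, 11, 19, 37, 41, 49, 70,
    74, 82, 100, 104, 112, 133, 137, 145], [7, 11, 19, 37, 41, 49, 70, 74, 82, 100, 104, 112,
    133, 137, 196], [7, 11, 19, 37, 41, 49, 70, 74, 82, 100, 104, 112, 133, 137, 208]]

/-- Certificate that one more triple through the last of eight points extends `eightSystems2` to
`eightSystems3`. -/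
def eightSystemsCert2 : List (List ℕ) :=
    [[370, 7202, 7202, 418, 7202, 7202, 4130, 4482, 7202, 5252, 7202, 7554, 7682, 6164, 7202, 7202,
    7554, 7682, 7812], [930, 244, 946, 246, 418, 962, 248, 4130, 4482, 5252, 7202, 7554, 7682,
    6164, 32869649, 7202, 7554, 7682, 32607569], [1392, 370, 7202, 7202, 418, 7202, 7202, 4130,
    4482, 7202, 5252, 7812, 7812, 6164, 7202, 7812, 7856, 7872, 7812], [980, 7812, 982, 7856,
    418, 984, 7872, 4130, 4482, 32607569, 5252, 6020, 6064, 6080, 6164, 32017763, 7812, 7856,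
    7872], [1952, 7202, 246, 418, 7202, 7328, 4130, 4482, 7202, 5252, 7202, 7554, 7682, 6164,
    7328, 7202, 7554, 7682, 7840], [930, 370, 7202, 418, 66424081, 7202, 4130, 4482, 980, 5252,
    378, 7812, 7812, 6164, 7202, 99978513, 99977617, 133532945, 7812], [946, 244, 7202, 418,
    7202, 7554, 4130, 4482, 7202, 5252, 7202, 7554, 7682, 6164, 7554, 7202, 7554, 7682, 7856],
    [2162, 2960, 99978513, 7328, 418, 99971345, 7328, 4130, 4482, 2170, 5252, 3024, 7840, 7840,
    6164, 7328, 96832797, 96825629, 7840], [946, 7554, 99977617, 3970, 418, 133525777, 7554,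
    4130, 4482, 982, 5252, 7856, 4048, 7856, 6164, 7554, 96832797, 130371997, 7856]]

/-- Representatives of the Berge-`K₄`-free systems on eight points with 4 triples through the last
point and 12 others. -/
def eightSystems4 : List (List ℕ) :=
    [[7, 11, 19, 37, 41, 49, 70, 74, 82, 100, 104, 112, 131, 161, 194, 224], [7, 11, 19, 37, 41, 49,
    70, 74, 82, 100, 104, 112, 133, 137, 145, 196], [7, 11, 19, 37, 41, 49, 70, 74, 82, 100,
    104, 112, 133, 137, 196, 200], [7, 11, 19, 37, 41, 49, 70, 74, 82, 100, 104, 112, 133, 137,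
    196, 208]]

/-- Certificate that one more triple through the last of eight points extends `eightSystems3` to
`eightSystems4`. -/
def eightSystemsCert3 : List (List ℕ) :=
    [[930, 244, 946, 246, 418, 962, 248, 4130, 4482, 5252, 7202, 7554, 7682, 6164, 7202, 7554, 7682,
    32869649], [930, 370, 7202, 418, 7202, 4130, 4482, 980, 5252, 378, 7812, 7812, 6164, 7202,
    66424081, 66423185, 66415121, 7812], [930, 370, 7202, 418, 66424081, 7202, 4130, 4482, 980,
    5252, 378, 7812, 7812, 6164, 7202, 99978513, 133532945, 7812], [930, 370, 7202, 418,
    66415121, 7202, 4130, 4482, 980, 5252, 378, 7812, 7812, 6164, 7202, 133532945, 133532049,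
    7812]]

/-- Representatives of the Berge-`K₄`-free systems on eight points with 5 triples through the last
point and 12 others. -/
def eightSystems5 : List (List ℕ) :=
    [[7, 11, 19, 37, 41, 49, 70, 74, 82, 100, 104, 112, 133, 137, 145, 196, 200]]

/-- Certificate that one more triple through the last of eight points extends `eightSystems4` to
`eightSystems5`. -/
def eightSystemsCert4 : List (List ℕ) :=
    [[930, 244, 946, 246, 418, 962, 248, 4130, 4482, 5252, 7202, 7554, 7682, 6164, 7202, 7554,
    7682], [930, 370, 7202, 418, 7202, 4130, 4482, 980, 5252, 378, 7812, 7812, 6164, 7202,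
    32869649, 32862481, 7812], [930, 370, 7202, 418, 32869649, 7202, 4130, 4482, 980, 5252, 378,
    7812, 7812, 6164, 7202, 29723933, 7812], [930, 370, 7202, 418, 32862481, 7202, 4130, 4482,
    980, 5252, 378, 7812, 7812, 6164, 7202, 29723933, 7812]]

/-- Representatives of the Berge-`K₄`-free systems on eight points with 6 triples through the last
point and 12 others. -/
def eightSystems6 : List (List ℕ) :=
    [[7, 11, 19, 37, 41, 49, 70, 74, 82, 100, 104, 112, 133, 137, 145, 196, 200, 208]]

/-- Certificate that one more triple through the last of eight points extends `eightSystems5` to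
`eightSystems6`. -/
def eightSystemsCert5 : List (List ℕ) :=
    [[930, 370, 7202, 418, 7202, 4130, 4482, 980, 5252, 378, 7812, 7812, 6164, 7202, 32869649,
    7812]]

/-- Certificate that one more triple through the last of eight points extends `eightSystems6` to a
Berge-`K₄`. -/
def eightSystemsCert6 : List (List ℕ) :=
    [[930, 370, 7202, 418, 7202, 4130, 4482, 980, 5252, 378, 7812, 7812, 6164, 7202, 7812]]

theorem checkLevel_six_zero :
    checkLevel 6 0 0 sixTriples sixSystems1 sixSystems0 sixSystemsCert0 = true := by
  decide +kernel

theorem checkLevel_six_one :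
    checkLevel 6 0 1 sixTriples sixSystems2 sixSystems1 sixSystemsCert1 = true := by
  decide +kernel

theorem checkLevel_six_two :
    checkLevel 6 0 2 sixTriples sixSystems3 sixSystems2 sixSystemsCert2 = true := by
  decide +kernel

theorem checkLevel_six_three :
    checkLevel 6 0 3 sixTriples sixSystems4 sixSystems3 sixSystemsCert3 = true := by
  decide +kernel

theorem checkLevel_six_four :
    checkLevel 6 0 4 sixTriples sixSystems5 sixSystems4 sixSystemsCert4 = true := by
  decide +kernel

theorem checkLevel_six_five :
    checkLevel 6 0 5 sixTriples sixSystems6 sixSystems5 sixSystemsCert5 = true := by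
  decide +kernel

theorem checkLevel_six_six :
    checkLevel 6 0 6 sixTriples sixSystems7 sixSystems6 sixSystemsCert6 = true := by
  decide +kernel

theorem checkLevel_six_seven :
    checkLevel 6 0 7 sixTriples sixSystems8 sixSystems7 sixSystemsCert7 = true := by
  decide +kernel

theorem checkLevel_six_eight :
    checkLevel 6 0 8 sixTriples [] sixSystems8 sixSystemsCert8 = true := by
  decide +kernel

theorem checkLevel_sevenOverEight_zero :
    checkLevel 7 64 0 sevenLinks sevenOverEight1 sixSystems8 sevenOverEightCert0 = true := by
  decide +kernel

theorem checkLevel_sevenOverEight_one :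
    checkLevel 7 64 1 sevenLinks sevenOverEight2 sevenOverEight1 sevenOverEightCert1 = true := by
  decide +kernel

theorem checkLevel_sevenOverEight_two :
    checkLevel 7 64 2 sevenLinks sevenOverEight3 sevenOverEight2 sevenOverEightCert2 = true := by
  decide +kernel

theorem checkLevel_sevenOverEight_three :
    checkLevel 7 64 3 sevenLinks sevenOverEight4 sevenOverEight3 sevenOverEightCert3 = true := by
  decide +kernel

theorem checkLevel_sevenOverSeven_zero :
    checkLevel 7 64 0 sevenLinks sevenOverSeven1 sixSystems7 sevenOverSevenCert0 = true := by
  decide +kernel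

theorem checkLevel_sevenOverSeven_one :
    checkLevel 7 64 1 sevenLinks sevenOverSeven2 sevenOverSeven1 sevenOverSevenCert1 = true := by
  decide +kernel

theorem checkLevel_sevenOverSeven_two :
    checkLevel 7 64 2 sevenLinks sevenOverSeven3 sevenOverSeven2 sevenOverSevenCert2 = true := by
  decide +kernel

theorem checkLevel_sevenOverSeven_three :
    checkLevel 7 64 3 sevenLinks sevenOverSeven4 sevenOverSeven3 sevenOverSevenCert3 = true := by
  decide +kernel

theorem checkLevel_sevenOverSeven_four :
    checkLevel 7 64 4 sevenLinks [] sevenOverSeven4 sevenOverSevenCert4 = true := by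
  decide +kernel

theorem checkLevel_seven :
    checkLevel 7 0 12 sevenTriples [] sevenOverEight4 sevenFullCert = true := by
  decide +kernel

theorem checkLevel_eight_zero :
    checkLevel 8 128 0 eightLinks eightSystems1 sevenOverEight4 eightSystemsCert0 = true := by
  decide +kernel

theorem checkLevel_eight_one :
    checkLevel 8 128 1 eightLinks eightSystems2 eightSystems1 eightSystemsCert1 = true := by
  decide +kernel

theorem checkLevel_eight_two :
    checkLevel 8 128 2 eightLinks eightSystems3 eightSystems2 eightSystemsCert2 = true := by
  decide +kernel

theorem checkLevel_eight_three :
    checkLevel 8 128 3 eightLinks eightSystems4 eightSystems3 eightSystemsCert3 = true := by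
  decide +kernel

theorem checkLevel_eight_four :
    checkLevel 8 128 4 eightLinks eightSystems5 eightSystems4 eightSystemsCert4 = true := by
  decide +kernel

theorem checkLevel_eight_five :
    checkLevel 8 128 5 eightLinks eightSystems6 eightSystems5 eightSystemsCert5 = true := by
  decide +kernel

theorem checkLevel_eight_six :
    checkLevel 8 128 6 eightLinks [] eightSystems6 eightSystemsCert6 = true := by
  decide +kernel

theorem mem_sixTriples : ∀ m < 2 ^ 6,
    ((Finset.range 6).filter fun i => m.testBit i = true).card = 3 → 0 &&& m = 0 →
      m ∈ sixTriples := by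
  decide +kernel

theorem mem_sevenTriples : ∀ m < 2 ^ 7,
    ((Finset.range 7).filter fun i => m.testBit i = true).card = 3 → 0 &&& m = 0 →
      m ∈ sevenTriples := by
  decide +kernel

theorem mem_sevenLinks : ∀ m < 2 ^ 7,
    ((Finset.range 7).filter fun i => m.testBit i = true).card = 3 → 64 &&& m = 64 →
      m ∈ sevenLinks := by
  decide +kernel

theorem mem_eightLinks : ∀ m < 2 ^ 8,
    ((Finset.range 8).filter fun i => m.testBit i = true).card = 3 → 128 &&& m = 128 →
      m ∈ eightLinks := by
  decide +kernel

section

variable {V : Type*} [DecidableEq V] {H : Finset (Finset V)} {U K : Finset V} {x : V} {n k : ℕ}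
  {Ls : List (List ℕ)}

theorem HasBergeK4.mono {G : Finset (Finset V)} (hGH : G ⊆ H) (h : HasBergeK4 G) :
    HasBergeK4 H := by
  obtain ⟨a, b, c, d, e₁, e₂, e₃, e₄, e₅, e₆, h₁, h₂, h₃, h₄, h₅, h₆, hnd, m₁, m₂, m₃, m₄, m₅, m₆,
    h⟩ := h
  exact ⟨a, b, c, d, e₁, e₂, e₃, e₄, e₅, e₆, h₁, h₂, h₃, h₄, h₅, h₆, hnd, hGH m₁, hGH m₂, hGH m₃,
    hGH m₄, hGH m₅, hGH m₆, h⟩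

theorem HasCopy.mono {G : Finset (Finset V)} (hGH : G ⊆ H) (h : HasCopy G U K n k Ls) :
    HasCopy H U K n k Ls := by
  obtain ⟨e, he, hU, hK, L, hL, hLG⟩ := h
  exact ⟨e, he, hU, hK, L, hL, fun m hm => hGH (hLG m hm)⟩

theorem not_hasCopy_nil : ¬ HasCopy H U K n k [] := by
  rintro ⟨_, _, _, _, L, hL, _⟩
  exact List.not_mem_nil hL

theorem decodeMask_zero (e : ℕ → V) (n : ℕ) : decodeMask e n 0 = ∅ := by
  simp [decodeMask]

theorem HasCopy.forget (h : HasCopy H U K n k Ls) : HasCopy H U ∅ n 0 Ls := by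
  obtain ⟨e, he, hU, -, h⟩ := h
  exact ⟨e, he, hU, decodeMask_zero e n, h⟩

theorem hasCopy_singleton_nil (hU : U.card = n) (hne : U.Nonempty) : HasCopy H U ∅ n 0 [[]] := by
  obtain ⟨v, -⟩ := hne
  have f := (Finset.equivFinOfCardEq hU).symm
  refine ⟨fun i => if hi : i < n then f ⟨i, hi⟩ else v, ?_, ?_, decodeMask_zero _ _, [],
    List.mem_singleton_self _, fun m hm => absurd hm List.not_mem_nil⟩
  · intro i hi j hj hij
    have hi : i < n := by simpa using hi
    have hj : j < n := by simpa using hj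
    simpa [hi, hj] using hij
  · ext u
    rw [Finset.mem_image]
    constructor
    · rintro ⟨i, hi, rfl⟩
      rw [dif_pos (Finset.mem_range.1 hi)]
      exact (f _).2
    · intro hu
      refine ⟨(f.symm ⟨u, hu⟩).1, by simp, ?_⟩
      simp

theorem HasCopy.extend (h : HasCopy H (U.erase x) ∅ n 0 Ls) (hx : x ∈ U)
    (hLs : ∀ L ∈ Ls, ∀ m ∈ L, m < 2 ^ n) : HasCopy H U {x} (n + 1) (2 ^ n) Ls := by
  obtain ⟨e, he, hU, -, L, hL, hLH⟩ := h
  have hex : ∀ i < n, e i ∈ U.erase x := fun i hi =>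
    hU ▸ Finset.mem_image_of_mem e (Finset.mem_range.2 hi)
  refine ⟨fun i => if i = n then x else e i, ?_, ?_, ?_, L, hL, fun m hm => ?_⟩
  · intro i hi j hj hij
    have hi : i < n + 1 := by simpa using hi
    have hj : j < n + 1 := by simpa using hj
    by_cases hin : i = n <;> by_cases hjn : j = n
    · rw [hin, hjn]
    · simp only [hin, hjn, if_true, if_false] at hij
      exact absurd hij.symm (Finset.ne_of_mem_erase (hex j (by omega)))
    · simp only [hin, hjn, if_true, if_false] at hij
      exact absurd hij (Finset.ne_of_mem_erase (hex i (by omega)))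
    · simp only [hin, hjn, if_false] at hij
      exact he (by simp; omega) (by simp; omega) hij
  · rw [Finset.range_add_one, Finset.image_insert, if_pos rfl, ← Finset.insert_erase hx, ← hU]
    congr 1
    refine Finset.image_congr fun i hi => if_neg ?_
    have : i < n := by simpa using hi
    omega
  · ext v
    simp [mem_decodeMask, Nat.testBit_two_pow, eq_comm]
  · convert hLH m hm using 1
    ext v
    rw [mem_decodeMask, mem_decodeMask]
    constructor
    · rintro ⟨i, -, hi, rfl⟩
      have := lt_of_testBit_of_lt (hLs L hL m hm) hi
      exact ⟨i, this, hi, by rw [if_neg (by omega)]⟩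
    · rintro ⟨i, hin, hi, rfl⟩
      exact ⟨i, by omega, hi, by rw [if_neg (by omega)]⟩

theorem countBetween_erase_add (x : V) :
    countBetween H ∅ (U.erase x) + countBetween H {x} U = countBetween H ∅ U := by
  rw [countBetween, countBetween, countBetween, ← Finset.card_union_of_disjoint]
  · congr 1
    ext t
    simp only [Finset.mem_union, Finset.mem_filter, Finset.empty_subset, true_and,
      Finset.singleton_subset_iff, Finset.subset_erase]
    tauto
  · rw [Finset.disjoint_left]
    simp only [Finset.mem_filter, Finset.singleton_subset_iff, Finset.subset_erase]
    tauto

theorem exists_countBetween_singleton_lt (hH3 : ∀ t ∈ H, t.card = 3) {q : ℕ}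
    (h : 3 * countBetween H ∅ U < U.card * q) : ∃ x ∈ U, countBetween H {x} U < q := by
  by_contra! hcon
  have hsum : ∑ x ∈ U, countBetween H {x} U = 3 * countBetween H ∅ U := by
    have := Finset.sum_card_bipartiteAbove_eq_sum_card_bipartiteBelow
      (s := U) (t := H.filter fun t => ∅ ⊆ t ∧ t ⊆ U) (fun x t => x ∈ t)
    have hleft : ∀ x, countBetween H {x} U = ((H.filter fun t => ∅ ⊆ t ∧ t ⊆ U).bipartiteAbove
        (fun x t => x ∈ t) x).card := fun x => by
      rw [countBetween, Finset.bipartiteAbove, Finset.filter_filter]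
      simp [and_comm]
    rw [Finset.sum_congr rfl fun x _ => hleft x, this, mul_comm, countBetween]
    refine Finset.sum_const_nat fun t ht => ?_
    obtain ⟨htH, -, htU⟩ := Finset.mem_filter.1 ht
    rw [Finset.bipartiteBelow, Finset.filter_mem_eq_inter, Finset.inter_eq_right.2 htU, hH3 t htH]
  have := Finset.card_nsmul_le_sum U _ q hcon
  rw [hsum, smul_eq_mul] at this
  omega

theorem exists_subset_countBetween_eq {c : ℕ} (h : c ≤ countBetween H ∅ U) :
    ∃ G ⊆ H, countBetween G ∅ U = c := by
  obtain ⟨G, hG, hc⟩ := Finset.exists_subset_card_eq h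
  refine ⟨G, hG.trans (Finset.filter_subset _ _), ?_⟩
  rw [countBetween, Finset.filter_true_of_mem fun t ht => (Finset.mem_filter.1 (hG ht)).2, hc]

theorem hasCopy_sixSystems7 (hH3 : ∀ t ∈ H, t.card = 3) (hfree : ¬ HasBergeK4 H)
    (hU : U.card = 6) (h : 7 ≤ countBetween H ∅ U) : HasCopy H U ∅ 6 0 sixSystems7 := by
  have h0 : HasCopy H U ∅ 6 0 sixSystems0 :=
    hasCopy_singleton_nil hU (Finset.card_pos.1 (by omega))
  have h1 := h0.step hH3 hfree (by omega) (by norm_num) mem_sixTriples checkLevel_six_zero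
  have h2 := h1.step hH3 hfree (by omega) (by norm_num) mem_sixTriples checkLevel_six_one
  have h3 := h2.step hH3 hfree (by omega) (by norm_num) mem_sixTriples checkLevel_six_two
  have h4 := h3.step hH3 hfree (by omega) (by norm_num) mem_sixTriples checkLevel_six_three
  have h5 := h4.step hH3 hfree (by omega) (by norm_num) mem_sixTriples checkLevel_six_four
  have h6 := h5.step hH3 hfree (by omega) (by norm_num) mem_sixTriples checkLevel_six_five
  exact h6.step hH3 hfree (by omega) (by norm_num) mem_sixTriples checkLevel_six_six

theorem hasCopy_sixSystems8 (hH3 : ∀ t ∈ H, t.card = 3) (hfree : ¬ HasBergeK4 H)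
    (hU : U.card = 6) (h : 8 ≤ countBetween H ∅ U) : HasCopy H U ∅ 6 0 sixSystems8 :=
  (hasCopy_sixSystems7 hH3 hfree hU (by omega)).step hH3 hfree h (by norm_num) mem_sixTriples
    checkLevel_six_seven

theorem countBetween_le_of_card_eq_six (hH3 : ∀ t ∈ H, t.card = 3) (hfree : ¬ HasBergeK4 H)
    (hU : U.card = 6) : countBetween H ∅ U ≤ 8 := by
  by_contra! h
  exact not_hasCopy_nil ((hasCopy_sixSystems8 hH3 hfree hU (by omega)).step hH3 hfree h
    (by norm_num) mem_sixTriples checkLevel_six_eight)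

theorem hasCopy_sevenOverEight4 (hH3 : ∀ t ∈ H, t.card = 3) (hfree : ¬ HasBergeK4 H)
    (hU : U.card = 7) (h : 12 ≤ countBetween H ∅ U) : HasCopy H U ∅ 7 0 sevenOverEight4 := by
  obtain ⟨G, hGH, hG⟩ := exists_subset_countBetween_eq h
  have hG3 : ∀ t ∈ G, t.card = 3 := fun t ht => hH3 t (hGH ht)
  have hGfree : ¬ HasBergeK4 G := fun h => hfree (h.mono hGH)
  refine HasCopy.mono hGH ?_
  obtain ⟨x, hx, hdeg⟩ := exists_countBetween_singleton_lt (U := U) (q := 6) hG3 (by omega)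
  have hadd := countBetween_erase_add (H := G) (U := U) x
  have hU' : (U.erase x).card = 6 := by rw [Finset.card_erase_of_mem hx, hU]
  have hle := countBetween_le_of_card_eq_six hG3 hGfree hU'
  by_cases hd : countBetween G {x} U = 4
  · have h0 := (hasCopy_sixSystems8 hG3 hGfree hU' (by omega)).extend hx (by decide)
    have h1 := h0.step hG3 hGfree (by omega) (by norm_num) mem_sevenLinks
      checkLevel_sevenOverEight_zero
    have h2 := h1.step hG3 hGfree (by omega) (by norm_num) mem_sevenLinks
      checkLevel_sevenOverEight_one
    have h3 := h2.step hG3 hGfree (by omega) (by norm_num) mem_sevenLinks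
      checkLevel_sevenOverEight_two
    exact (h3.step hG3 hGfree (by omega) (by norm_num) mem_sevenLinks
      checkLevel_sevenOverEight_three).forget
  · have h0 := (hasCopy_sixSystems7 hG3 hGfree hU' (by omega)).extend hx (by decide)
    have h1 := h0.step hG3 hGfree (by omega) (by norm_num) mem_sevenLinks
      checkLevel_sevenOverSeven_zero
    have h2 := h1.step hG3 hGfree (by omega) (by norm_num) mem_sevenLinks
      checkLevel_sevenOverSeven_one
    have h3 := h2.step hG3 hGfree (by omega) (by norm_num) mem_sevenLinks
      checkLevel_sevenOverSeven_two
    have h4 := h3.step hG3 hGfree (by omega) (by norm_num) mem_sevenLinks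
      checkLevel_sevenOverSeven_three
    exact absurd (h4.step hG3 hGfree (by omega) (by norm_num) mem_sevenLinks
      checkLevel_sevenOverSeven_four) not_hasCopy_nil

theorem countBetween_le_of_card_eq_seven (hH3 : ∀ t ∈ H, t.card = 3) (hfree : ¬ HasBergeK4 H)
    (hU : U.card = 7) : countBetween H ∅ U ≤ 12 := by
  by_contra! h
  exact not_hasCopy_nil ((hasCopy_sevenOverEight4 hH3 hfree hU h.le).step hH3 hfree h
    (by norm_num) mem_sevenTriples checkLevel_seven)

theorem countBetween_le_of_card_eq_eight (hH3 : ∀ t ∈ H, t.card = 3) (hfree : ¬ HasBergeK4 H)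
    (hU : U.card = 8) : countBetween H ∅ U ≤ 18 := by
  by_contra! h
  obtain ⟨G, hGH, hG⟩ := exists_subset_countBetween_eq (Nat.succ_le_of_lt h)
  have hG3 : ∀ t ∈ G, t.card = 3 := fun t ht => hH3 t (hGH ht)
  have hGfree : ¬ HasBergeK4 G := fun h => hfree (h.mono hGH)
  obtain ⟨x, hx, hdeg⟩ := exists_countBetween_singleton_lt (U := U) (q := 8) hG3 (by omega)
  have hadd := countBetween_erase_add (H := G) (U := U) x
  have hU' : (U.erase x).card = 7 := by rw [Finset.card_erase_of_mem hx, hU]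
  have hle := countBetween_le_of_card_eq_seven hG3 hGfree hU'
  have h0 := (hasCopy_sevenOverEight4 hG3 hGfree hU' (by omega)).extend hx (by decide)
  have h1 := h0.step hG3 hGfree (by omega) (by norm_num) mem_eightLinks checkLevel_eight_zero
  have h2 := h1.step hG3 hGfree (by omega) (by norm_num) mem_eightLinks checkLevel_eight_one
  have h3 := h2.step hG3 hGfree (by omega) (by norm_num) mem_eightLinks checkLevel_eight_two
  have h4 := h3.step hG3 hGfree (by omega) (by norm_num) mem_eightLinks checkLevel_eight_three
  have h5 := h4.step hG3 hGfree (by omega) (by norm_num) mem_eightLinks checkLevel_eight_four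
  have h6 := h5.step hG3 hGfree (by omega) (by norm_num) mem_eightLinks checkLevel_eight_five
  exact not_hasCopy_nil (h6.step hG3 hGfree (by omega) (by norm_num) mem_eightLinks
    checkLevel_eight_six)

theorem countBetween_empty_univ [Fintype V] : countBetween H ∅ Finset.univ = H.card := by
  simp [countBetween]

end

/-- For every `n ≥ 6`, every Berge-`K₄`-free triple system on
an `n`-element vertex set has at most `⌊n/3⌋ * ⌊(n+1)/3⌋ * ⌊(n+2)/3⌋` triples. -/
theorem bergeK4_free_card_le (n : ℕ) (hn : 6 ≤ n)
    (V : Type*) [DecidableEq V] [Fintype V] (hV : Fintype.card V = n)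
    (H : Finset (Finset V)) (hH3 : ∀ t ∈ H, t.card = 3)
    (hfree : ¬ HasBergeK4 H) :
    H.card ≤ n / 3 * ((n + 1) / 3) * ((n + 2) / 3) := by
  obtain rfl | rfl | rfl | hn9 : n = 6 ∨ n = 7 ∨ n = 8 ∨ 9 ≤ n := by omega
  · exact countBetween_empty_univ (H := H) ▸ countBetween_le_of_card_eq_six hH3 hfree hV
  · exact countBetween_empty_univ (H := H) ▸ countBetween_le_of_card_eq_seven hH3 hfree hV
  · exact countBetween_empty_univ (H := H) ▸ countBetween_le_of_card_eq_eight hH3 hfree hV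
  · subst hV
    exact card_le_tripartite_of_nine_le hn9 hH3 hfree
end

section
/- Let V be a finite vertex set partitioned into three parts A, B, C, and let H be the complete 3-partite triple system consisting of all triples {a, b, c} with a ∈ A, b ∈ B, c ∈ C. Then H is Berge-K4-free. Moreover, if |V| = n and the parts have sizes ⌊n/3⌋, ⌊(n+1)/3⌋ and ⌊(n+2)/3⌋, then H has exactly f(n) = ⌊n/3⌋·⌊(n+1)/3⌋·⌊(n+2)/3⌋ triples. -/
/-- A set system in which every member is properly coloured by three colours
is Berge-`K₄`-free. -/
theorem not_hasBergeK4_of_injOn {V : Type*} [DecidableEq V] {H : Finset (Finset V)}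
    (f : V → Fin 3) (hf : ∀ t ∈ H, Set.InjOn f (t : Set V)) : ¬ HasBergeK4 H := by
  rintro ⟨v₁, v₂, v₃, v₄, e₁₂, e₁₃, e₁₄, e₂₃, e₂₄, e₃₄, n₁₂, n₁₃, n₁₄, n₂₃, n₂₄, n₃₄, -,
    h₁₂, h₁₃, h₁₄, h₂₃, h₂₄, h₃₄, s₁₂, s₁₃, s₁₄, s₂₃, s₂₄, s₃₄⟩
  have key : ∀ {v w : V} {e : Finset V}, v ≠ w → e ∈ H → {v, w} ⊆ e → f v ≠ f w :=
    fun hne he hs => (hf _ he).ne (hs (by simp)) (hs (by simp)) hne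
  have c₁₂ := key n₁₂ h₁₂ s₁₂
  have c₁₃ := key n₁₃ h₁₃ s₁₃
  have c₁₄ := key n₁₄ h₁₄ s₁₄
  have c₂₃ := key n₂₃ h₂₃ s₂₃
  have c₂₄ := key n₂₄ h₂₄ s₂₄
  have c₃₄ := key n₃₄ h₃₄ s₃₄
  omega

/-- For pairwise disjoint sets `A`, `B`, `C`, a transversal triple `{a, b, c}`
determines `a`, `b` and `c`. -/
theorem injOn_transversal_triple {V : Type*} [DecidableEq V] {A B C : Finset V}
    (hAB : Disjoint A B) (hAC : Disjoint A C) (hBC : Disjoint B C) :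
    Set.InjOn (fun p : V × V × V => ({p.1, p.2.1, p.2.2} : Finset V))
      (A ×ˢ B ×ˢ C : Finset (V × V × V)) := by
  rintro ⟨a, b, c⟩ h ⟨a', b', c'⟩ h' heq
  simp only [Finset.coe_product, Set.mem_prod, Finset.mem_coe] at h h'
  obtain ⟨ha, hb, hc⟩ := h
  obtain ⟨ha', hb', hc'⟩ := h'
  rw [Finset.disjoint_left] at hAB hAC hBC
  have heq : ∀ x, x ∈ ({a, b, c} : Finset V) ↔ x ∈ ({a', b', c'} : Finset V) :=
    Finset.ext_iff.mp heq
  simp only [Finset.mem_insert, Finset.mem_singleton] at heq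
  have h₁ := (heq a).mp (by simp)
  have h₂ := (heq b).mp (by simp)
  have h₃ := (heq c).mp (by simp)
  grind

/-- The number of transversal triples of pairwise disjoint sets. -/
theorem card_transversal_triples {V : Type*} [DecidableEq V] {A B C : Finset V}
    (hAB : Disjoint A B) (hAC : Disjoint A C) (hBC : Disjoint B C) {H : Finset (Finset V)}
    (hH : ∀ t : Finset V, t ∈ H ↔ ∃ a ∈ A, ∃ b ∈ B, ∃ c ∈ C, t = {a, b, c}) :
    H.card = A.card * B.card * C.card := by
  have hImage : H = (A ×ˢ B ×ˢ C).image fun p => {p.1, p.2.1, p.2.2} := by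
    ext t
    rw [hH]
    simp only [Finset.mem_image, Finset.mem_product, Prod.exists]
    grind
  rw [hImage, Finset.card_image_of_injOn (injOn_transversal_triple hAB hAC hBC),
    Finset.card_product, Finset.card_product, mul_assoc]

/-- The complete 3-partite triple system with parts `A`, `B`, `C`
is Berge-`K₄`-free; moreover, if `|V| = n` and the parts have sizes `⌊n/3⌋`,
`⌊(n+1)/3⌋`, `⌊(n+2)/3⌋`, then it has exactly `⌊n/3⌋ * ⌊(n+1)/3⌋ * ⌊(n+2)/3⌋`
triples. -/
theorem complete_tripartite_bergeK4_free
    (V : Type*) [DecidableEq V] [Fintype V] (A B C : Finset V)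
    (hcover : A ∪ B ∪ C = Finset.univ)
    (hAB : Disjoint A B) (hAC : Disjoint A C) (hBC : Disjoint B C)
    (H : Finset (Finset V))
    (hH : ∀ t : Finset V, t ∈ H ↔ ∃ a ∈ A, ∃ b ∈ B, ∃ c ∈ C, t = {a, b, c})
    (n : ℕ) :
    ¬ HasBergeK4 H ∧
    (Fintype.card V = n → A.card = n / 3 → B.card = (n + 1) / 3 →
      C.card = (n + 2) / 3 →
      H.card = n / 3 * ((n + 1) / 3) * ((n + 2) / 3)) := by
  refine ⟨?_, fun _ hA hB hC => ?_⟩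
  · refine not_hasBergeK4_of_injOn (fun v => if v ∈ A then 0 else if v ∈ B then 1 else 2) ?_
    intro t ht
    obtain ⟨a, ha, b, hb, c, hc, rfl⟩ := (hH t).mp ht
    have hbA := Finset.disjoint_right.mp hAB hb
    have hcA := Finset.disjoint_right.mp hAC hc
    have hcB := Finset.disjoint_right.mp hBC hc
    intro v hv w hw hvw
    simp only [Finset.coe_insert, Finset.coe_singleton, Set.mem_insert_iff,
      Set.mem_singleton_iff] at hv hw
    rcases hv with rfl | rfl | rfl <;> rcases hw with rfl | rfl | rfl <;> simp_all
  · rw [card_transversal_triples hAB hAC hBC hH, hA, hB, hC]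
end
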